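/- arXiv:1912.00309 — 4 statements merged into one kernel-verified Lean document; each statement's English description precedes it below -/
import Mathlib

section
/- Let m ≥ 5 and let π = (d_1, …, d_{2m+1}) be a non-increasing graphic sequence of length 2m+1 with d_i = m for 2 ≤ i ≤ m+2 and d_{2m+1−i} = i+1 for 1 ≤ i ≤ m−2. If either (d_{2m+1} = 2 and d_1 ≥ m+1) or (d_{2m+1} = 1 and d_1 = m), then π has a realization G containing cycles C_3, …, C_{2m} all lying on the 2m vertices of G whose degrees are d_1, …, d_{2m}. -/
/-- `G` contains a cycle of length `r`. -/
def hasCycleOfLength {V : Type*} (G : SimpleGraph V) (r : ℕ) : Prop :=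
  ∃ (v : V) (c : G.Walk v v), c.IsCycle ∧ c.length = r

/-- `G` is a realization of the sequence `d`, i.e. `d` is its degree sequence. -/
def IsDegreeSeq {n : ℕ} (G : SimpleGraph (Fin n)) (d : Fin n → ℕ) : Prop :=
  ∀ i, (G.neighborSet i).ncard = d i

/-- The sequence `d` is graphic: it is the degree sequence of a simple graph. -/
def Graphic {n : ℕ} (d : Fin n → ℕ) : Prop :=
  ∃ G : SimpleGraph (Fin n), IsDegreeSeq G d

/-- `d` is potentially ₃Cℓ-graphic: some realization contains cycles of every
length `r` with `3 ≤ r ≤ ℓ`. -/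
def Pot3C {n : ℕ} (ℓ : ℕ) (d : Fin n → ℕ) : Prop :=
  ∃ G : SimpleGraph (Fin n), IsDegreeSeq G d ∧ ∀ r, 3 ≤ r → r ≤ ℓ → hasCycleOfLength G r

/-- `d` is potentially Cℓ-graphic: some realization contains a cycle of length `ℓ`. -/
def PotC {n : ℕ} (ℓ : ℕ) (d : Fin n → ℕ) : Prop :=
  ∃ G : SimpleGraph (Fin n), IsDegreeSeq G d ∧ hasCycleOfLength G ℓ

/-- `d` has a realization `G` containing cycles `C₃, …, C_ℓ` on those vertices with
degrees `d 0, …, d (ℓ-1)`: the induced subgraph on some vertex set `S`, whose multiset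
of degrees is that of the first `ℓ` terms of `d`, contains cycles of all lengths
from `3` to `ℓ`. -/
def RealizationWithCyclesOn {n : ℕ} (ℓ : ℕ) (d : Fin n → ℕ) : Prop :=
  ∃ (G : SimpleGraph (Fin n)) (S : Finset (Fin n)),
    IsDegreeSeq G d ∧ S.card = ℓ ∧
    S.val.map d = (Finset.univ.filter (fun i : Fin n => (i : ℕ) < ℓ)).val.map d ∧
    ∀ r, 3 ≤ r → r ≤ ℓ → hasCycleOfLength (G.induce (S : Set (Fin n))) r

set_option linter.unusedTactic false
set_option linter.unreachableTactic false

/-- upper triangular part of the adjacency of the explicit realization -/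
def R26 (m h s b c i j : ℕ) : Prop :=
  (i = 0 ∧ ((m + 1 ≤ j ∧ j + 1 ≤ 2 * m) ∨ j = h ∨ (h + 2 * s < j ∧ j ≤ m) ∨
      (b = 1 ∧ h < j ∧ j ≤ m) ∨ (b = 1 ∧ 1 ≤ j ∧ j ≤ 2 * s) ∨ (c = 1 ∧ j = 2 * m))) ∨
  (1 ≤ i ∧ i ≤ h ∧ h < j ∧ j ≤ m ∧ ¬ (b = 1 ∧ i ≤ 2 * s ∧ j = h + i)) ∨
  (h < i ∧ j = i + 1 ∧ j ≤ h + 2 * s ∧ (i - h) % 2 = 1) ∨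
  (2 ≤ i ∧ i ≤ m ∧ i ≠ h ∧ j = m + 1) ∨
  (1 ≤ i ∧ i ≤ m ∧ m + 2 ≤ j ∧ j + 1 ≤ 2 * m ∧
    ((2 * m ≤ j + h ∧ i + j ≤ 2 * m) ∨ (j + h < 2 * m ∧ j < i + m))) ∨
  (i = m + 1 ∧ j = 2 * m)

def A26 (m h s b c i j : ℕ) : Prop := R26 m h s b c i j ∨ R26 m h s b c j i

/-- validity of parameters -/
def OK26 (m h s b c : ℕ) : Prop :=
  5 ≤ m ∧ 2 * h ≤ m ∧ m ≤ 2 * h + 1 ∧ b ≤ 1 ∧ c ≤ 1 ∧ 2 * s + h ≤ m ∧ (b = 1 → 2 * s + 1 ≤ h)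

lemma R26_lt {m h s b c i j : ℕ} (ok : OK26 m h s b c) (hr : R26 m h s b c i j) : i < j := by
  unfold OK26 at ok
  unfold R26 at hr
  omega

def G26 (m h s b c : ℕ) (ok : OK26 m h s b c) : SimpleGraph (Fin (2 * m + 1)) where
  Adj i j := A26 m h s b c i j
  symm := ⟨fun i j hij => Or.symm hij⟩
  loopless := ⟨fun i hi => by
    rcases hi with hi | hi <;> exact absurd (R26_lt ok hi) (lt_irrefl _)⟩

lemma cnt26 (n : ℕ) (Q : ℕ → Prop) (a1 b1 a2 b2 a3 b3 a4 b4 a5 b5 : ℕ)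
    (hord : a1 ≤ b1 ∧ b1 ≤ a2 ∧ a2 ≤ b2 ∧ b2 ≤ a3 ∧ a3 ≤ b3 ∧ b3 ≤ a4 ∧ a4 ≤ b4 ∧ b4 ≤ a5 ∧
      a5 ≤ b5 ∧ b5 ≤ n)
    (hQ : ∀ j, j < n → (Q j ↔ (a1 ≤ j ∧ j < b1) ∨ (a2 ≤ j ∧ j < b2) ∨ (a3 ≤ j ∧ j < b3) ∨
      (a4 ≤ j ∧ j < b4) ∨ (a5 ≤ j ∧ j < b5))) :
    ({j : Fin n | Q j} : Set (Fin n)).ncard =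
      (b1 - a1) + (b2 - a2) + (b3 - a3) + (b4 - a4) + (b5 - a5) := by
  classical
  have h1 : ({j : Fin n | Q j} : Set (Fin n)).ncard =
      (((Finset.Ico a1 b1 ∪ Finset.Ico a2 b2) ∪ Finset.Ico a3 b3) ∪ Finset.Ico a4 b4 ∪
        Finset.Ico a5 b5).card := by
    rw [← Set.ncard_image_of_injective _ Fin.val_injective, ← Set.ncard_coe_finset]
    congr 1
    ext x
    simp only [Set.mem_image, Set.mem_ofPred_eq, Finset.coe_union, Finset.coe_Ico, Set.mem_union,
      Set.mem_Ico]
    constructor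
    · rintro ⟨j, hj, rfl⟩
      have := (hQ j j.2).1 hj
      tauto
    · intro hx
      have hxn : x < n := by omega
      refine ⟨⟨x, hxn⟩, (hQ x hxn).2 (by tauto), rfl⟩
  rw [h1, Finset.card_union_of_disjoint, Finset.card_union_of_disjoint,
    Finset.card_union_of_disjoint, Finset.card_union_of_disjoint]
  · simp only [Nat.card_Ico]
  all_goals
    rw [Finset.disjoint_left]
    intro x hx hx'
    simp only [Finset.mem_union, Finset.mem_Ico] at hx hx'
    omega

set_option maxHeartbeats 4000000 in
lemma deg26_v (m h s b c : ℕ) (ok : OK26 m h s b c) :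
    ({j : Fin (2 * m + 1) | A26 m h s b c 0 j} : Set _).ncard =
      if b = 1 then 2 * m - h + 2 * s + c else 2 * m - h - 2 * s + c := by
  unfold OK26 at ok
  split_ifs with hb
  · rw [cnt26 (2 * m + 1) (fun j => A26 m h s b c 0 j) 1 (2 * s + 1) h (2 * m + c)
      (2 * m + c) (2 * m + c) (2 * m + c) (2 * m + c) (2 * m + c) (2 * m + c) (by omega)]
    · omega
    · intro j hj
      unfold A26 R26
      constructor
      · rintro ((h | h | h | h | h | h) | (h | h | h | h | h | h)) <;> omega
      · intro hint
        by_cases hj0 : j = 0 <;> by_cases hj1 : j = m + 1 <;> by_cases hj2 : j ≤ h <;>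
          rcases hint with h | h | h | h | h
        all_goals
          first
            | exact Or.inl (Or.inl (by omega))
            | exact Or.inl (Or.inr (Or.inl (by omega)))
            | exact Or.inl (Or.inr (Or.inr (Or.inl (by omega))))
            | exact Or.inl (Or.inr (Or.inr (Or.inr (Or.inl (by omega)))))
            | exact Or.inl (Or.inr (Or.inr (Or.inr (Or.inr (Or.inl (by omega))))))
            | exact Or.inl (Or.inr (Or.inr (Or.inr (Or.inr (Or.inr (by omega))))))
            | exact Or.inr (Or.inl (by omega))
            | exact Or.inr (Or.inr (Or.inl (by omega)))
            | exact Or.inr (Or.inr (Or.inr (Or.inl (by omega))))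
            | exact Or.inr (Or.inr (Or.inr (Or.inr (Or.inl (by omega)))))
            | exact Or.inr (Or.inr (Or.inr (Or.inr (Or.inr (Or.inl (by omega))))))
            | exact Or.inr (Or.inr (Or.inr (Or.inr (Or.inr (Or.inr (by omega))))))
  · rw [cnt26 (2 * m + 1) (fun j => A26 m h s b c 0 j) h (h + 1) (h + 2 * s + 1) (2 * m + c)
      (2 * m + c) (2 * m + c) (2 * m + c) (2 * m + c) (2 * m + c) (2 * m + c) (by omega)]
    · omega
    · intro j hj
      unfold A26 R26
      constructor
      · rintro ((h | h | h | h | h | h) | (h | h | h | h | h | h)) <;> omega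
      · intro hint
        by_cases hj0 : j = 0 <;> by_cases hj1 : j = m + 1 <;> by_cases hj2 : j ≤ h <;>
          rcases hint with h | h | h | h | h
        all_goals
          first
            | exact Or.inl (Or.inl (by omega))
            | exact Or.inl (Or.inr (Or.inl (by omega)))
            | exact Or.inl (Or.inr (Or.inr (Or.inl (by omega))))
            | exact Or.inl (Or.inr (Or.inr (Or.inr (Or.inl (by omega)))))
            | exact Or.inl (Or.inr (Or.inr (Or.inr (Or.inr (Or.inl (by omega))))))
            | exact Or.inl (Or.inr (Or.inr (Or.inr (Or.inr (Or.inr (by omega))))))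
            | exact Or.inr (Or.inl (by omega))
            | exact Or.inr (Or.inr (Or.inl (by omega)))
            | exact Or.inr (Or.inr (Or.inr (Or.inl (by omega))))
            | exact Or.inr (Or.inr (Or.inr (Or.inr (Or.inl (by omega)))))
            | exact Or.inr (Or.inr (Or.inr (Or.inr (Or.inr (Or.inl (by omega))))))
            | exact Or.inr (Or.inr (Or.inr (Or.inr (Or.inr (Or.inr (by omega))))))

set_option maxHeartbeats 4000000 in
lemma deg26_Q (m h s b c i : ℕ) (ok : OK26 m h s b c) (hi : 1 ≤ i) (hi' : i ≤ h) :
    ({j : Fin (2 * m + 1) | A26 m h s b c i j} : Set _).ncard = m := by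
  unfold OK26 at ok
  obtain ⟨x, hx⟩ : ∃ x, x = if (b = 1 ∧ i ≤ 2 * s) then 1 else 0 := ⟨_, rfl⟩
  obtain ⟨y, hy⟩ : ∃ y, y = if (i = h) then 1 else 0 := ⟨_, rfl⟩
  obtain ⟨z, hz⟩ : ∃ z, z = if (i = 1 ∨ i = h) then 1 else 0 := ⟨_, rfl⟩
  by_cases h1 : i = 1
  · rw [cnt26 (2 * m + 1) (fun j => A26 m h s b c i j) 0 x (h + 1) (h + i) (h + i + x) (m + 1)
      (m + 2) (m + 2) (2 * m - h) (2 * m - i + 1)]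
    · split_ifs at hx <;> omega
    · split_ifs at hx <;> omega
    · intro j hj
      unfold A26 R26
      split_ifs at hx
      all_goals
        constructor
        · rintro ((h | h | h | h | h | h) | (h | h | h | h | h | h)) <;> omega
        · intro hint
          by_cases hj0 : j = 0 <;> by_cases hj1 : j = m + 1 <;> by_cases hj2 : j ≤ h <;>
            rcases hint with h | h | h | h | h
          all_goals
            first
              | exact Or.inl (Or.inl (by omega))
              | exact Or.inl (Or.inr (Or.inl (by omega)))
              | exact Or.inl (Or.inr (Or.inr (Or.inl (by omega))))
              | exact Or.inl (Or.inr (Or.inr (Or.inr (Or.inl (by omega)))))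
              | exact Or.inl (Or.inr (Or.inr (Or.inr (Or.inr (Or.inl (by omega))))))
              | exact Or.inl (Or.inr (Or.inr (Or.inr (Or.inr (Or.inr (by omega))))))
              | exact Or.inr (Or.inl (by omega))
              | exact Or.inr (Or.inr (Or.inl (by omega)))
              | exact Or.inr (Or.inr (Or.inr (Or.inl (by omega))))
              | exact Or.inr (Or.inr (Or.inr (Or.inr (Or.inl (by omega)))))
              | exact Or.inr (Or.inr (Or.inr (Or.inr (Or.inr (Or.inl (by omega))))))
              | exact Or.inr (Or.inr (Or.inr (Or.inr (Or.inr (Or.inr (by omega))))))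
  · rw [cnt26 (2 * m + 1) (fun j => A26 m h s b c i j) 0 (x + y) (h + 1) (h + i) (h + i + x) (m + 1)
      (m + 1 + y) (m + i) (2 * m - h) (2 * m - i + 1)]
    · split_ifs at hx hy <;> omega
    · split_ifs at hx hy <;> omega
    · intro j hj
      unfold A26 R26
      split_ifs at hx hy
      all_goals
        constructor
        · rintro ((h | h | h | h | h | h) | (h | h | h | h | h | h)) <;> omega
        · intro hint
          by_cases hj0 : j = 0 <;> by_cases hj1 : j = m + 1 <;> by_cases hj2 : j ≤ h <;>
            rcases hint with h | h | h | h | h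
          all_goals
            first
              | exact Or.inl (Or.inl (by omega))
              | exact Or.inl (Or.inr (Or.inl (by omega)))
              | exact Or.inl (Or.inr (Or.inr (Or.inl (by omega))))
              | exact Or.inl (Or.inr (Or.inr (Or.inr (Or.inl (by omega)))))
              | exact Or.inl (Or.inr (Or.inr (Or.inr (Or.inr (Or.inl (by omega))))))
              | exact Or.inl (Or.inr (Or.inr (Or.inr (Or.inr (Or.inr (by omega))))))
              | exact Or.inr (Or.inl (by omega))
              | exact Or.inr (Or.inr (Or.inl (by omega)))
              | exact Or.inr (Or.inr (Or.inr (Or.inl (by omega))))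
              | exact Or.inr (Or.inr (Or.inr (Or.inr (Or.inl (by omega)))))
              | exact Or.inr (Or.inr (Or.inr (Or.inr (Or.inr (Or.inl (by omega))))))
              | exact Or.inr (Or.inr (Or.inr (Or.inr (Or.inr (Or.inr (by omega))))))

set_option maxHeartbeats 4000000 in
lemma deg26_P (m h s b c i : ℕ) (ok : OK26 m h s b c) (hi : h < i) (hi' : i ≤ m) :
    ({j : Fin (2 * m + 1) | A26 m h s b c i j} : Set _).ncard = m := by
  unfold OK26 at ok
  by_cases h2 : i ≤ h + 2 * s
  · obtain ⟨q, hq⟩ : ∃ q, q = if ((i - h) % 2 = 1) then i + 1 else i - 1 := ⟨_, rfl⟩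
    by_cases hb : b = 1
    · rw [cnt26 (2 * m + 1) (fun j => A26 m h s b c i j) 0 (i - h) (i - h + 1) (h + 1) q (q + 1)
        (m + 1) (2 * m - h) (2 * m - h) (2 * m - h)]
      · omega
      · split_ifs at hq <;> omega
      · intro j hj
        unfold A26 R26
        split_ifs at hq
        all_goals
          constructor
          · rintro ((h | h | h | h | h | h) | (h | h | h | h | h | h)) <;> omega
          · intro hint
            by_cases hj0 : j = 0 <;> by_cases hj1 : j = m + 1 <;> by_cases hj2 : j ≤ h <;>
              rcases hint with h | h | h | h | h
            all_goals
              first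
                | exact Or.inl (Or.inl (by omega))
                | exact Or.inl (Or.inr (Or.inl (by omega)))
                | exact Or.inl (Or.inr (Or.inr (Or.inl (by omega))))
                | exact Or.inl (Or.inr (Or.inr (Or.inr (Or.inl (by omega)))))
                | exact Or.inl (Or.inr (Or.inr (Or.inr (Or.inr (Or.inl (by omega))))))
                | exact Or.inl (Or.inr (Or.inr (Or.inr (Or.inr (Or.inr (by omega))))))
                | exact Or.inr (Or.inl (by omega))
                | exact Or.inr (Or.inr (Or.inl (by omega)))
                | exact Or.inr (Or.inr (Or.inr (Or.inl (by omega))))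
                | exact Or.inr (Or.inr (Or.inr (Or.inr (Or.inl (by omega)))))
                | exact Or.inr (Or.inr (Or.inr (Or.inr (Or.inr (Or.inl (by omega))))))
                | exact Or.inr (Or.inr (Or.inr (Or.inr (Or.inr (Or.inr (by omega))))))
    · rw [cnt26 (2 * m + 1) (fun j => A26 m h s b c i j) 1 (h + 1) q (q + 1)
        (m + 1) (2 * m - h) (2 * m - h) (2 * m - h) (2 * m - h) (2 * m - h)]
      · omega
      · split_ifs at hq <;> omega
      · intro j hj
        unfold A26 R26
        split_ifs at hq
        all_goals
          constructor
          · rintro ((h | h | h | h | h | h) | (h | h | h | h | h | h)) <;> omega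
          · intro hint
            by_cases hj0 : j = 0 <;> by_cases hj1 : j = m + 1 <;> by_cases hj2 : j ≤ h <;>
              rcases hint with h | h | h | h | h
            all_goals
              first
                | exact Or.inl (Or.inl (by omega))
                | exact Or.inl (Or.inr (Or.inl (by omega)))
                | exact Or.inl (Or.inr (Or.inr (Or.inl (by omega))))
                | exact Or.inl (Or.inr (Or.inr (Or.inr (Or.inl (by omega)))))
                | exact Or.inl (Or.inr (Or.inr (Or.inr (Or.inr (Or.inl (by omega))))))
                | exact Or.inl (Or.inr (Or.inr (Or.inr (Or.inr (Or.inr (by omega))))))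
                | exact Or.inr (Or.inl (by omega))
                | exact Or.inr (Or.inr (Or.inl (by omega)))
                | exact Or.inr (Or.inr (Or.inr (Or.inl (by omega))))
                | exact Or.inr (Or.inr (Or.inr (Or.inr (Or.inl (by omega)))))
                | exact Or.inr (Or.inr (Or.inr (Or.inr (Or.inr (Or.inl (by omega))))))
                | exact Or.inr (Or.inr (Or.inr (Or.inr (Or.inr (Or.inr (by omega))))))
  · rw [cnt26 (2 * m + 1) (fun j => A26 m h s b c i j) 0 (h + 1)
        (m + 1) (2 * m - h) (2 * m - h) (2 * m - h) (2 * m - h) (2 * m - h) (2 * m - h) (2 * m - h)]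
    · omega
    · omega
    · intro j hj
      unfold A26 R26
      constructor
      · rintro ((h | h | h | h | h | h) | (h | h | h | h | h | h)) <;> omega
      · intro hint
        by_cases hj0 : j = 0 <;> by_cases hj1 : j = m + 1 <;> by_cases hj2 : j ≤ h <;>
          rcases hint with h | h | h | h | h
        all_goals
          first
            | exact Or.inl (Or.inl (by omega))
            | exact Or.inl (Or.inr (Or.inl (by omega)))
            | exact Or.inl (Or.inr (Or.inr (Or.inl (by omega))))
            | exact Or.inl (Or.inr (Or.inr (Or.inr (Or.inl (by omega)))))
            | exact Or.inl (Or.inr (Or.inr (Or.inr (Or.inr (Or.inl (by omega))))))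
            | exact Or.inl (Or.inr (Or.inr (Or.inr (Or.inr (Or.inr (by omega))))))
            | exact Or.inr (Or.inl (by omega))
            | exact Or.inr (Or.inr (Or.inl (by omega)))
            | exact Or.inr (Or.inr (Or.inr (Or.inl (by omega))))
            | exact Or.inr (Or.inr (Or.inr (Or.inr (Or.inl (by omega)))))
            | exact Or.inr (Or.inr (Or.inr (Or.inr (Or.inr (Or.inl (by omega))))))
            | exact Or.inr (Or.inr (Or.inr (Or.inr (Or.inr (Or.inr (by omega))))))

set_option maxHeartbeats 4000000 in
lemma deg26_t' (m h s b c : ℕ) (ok : OK26 m h s b c) :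
    ({j : Fin (2 * m + 1) | A26 m h s b c (m + 1) j} : Set _).ncard = m := by
  unfold OK26 at ok
  rw [cnt26 (2 * m + 1) (fun j => A26 m h s b c (m + 1) j) 0 1 2 h (h + 1) (m + 1)
    (2 * m) (2 * m + 1) (2 * m + 1) (2 * m + 1)]
  · omega
  · omega
  · intro j hj
    unfold A26 R26
    constructor
    · rintro ((h | h | h | h | h | h) | (h | h | h | h | h | h)) <;> omega
    · intro hint
      by_cases hj0 : j = 0 <;> by_cases hj1 : j = m + 1 <;> by_cases hj2 : j ≤ h <;>
        rcases hint with h | h | h | h | h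
      all_goals
        first
          | exact Or.inl (Or.inl (by omega))
          | exact Or.inl (Or.inr (Or.inl (by omega)))
          | exact Or.inl (Or.inr (Or.inr (Or.inl (by omega))))
          | exact Or.inl (Or.inr (Or.inr (Or.inr (Or.inl (by omega)))))
          | exact Or.inl (Or.inr (Or.inr (Or.inr (Or.inr (Or.inl (by omega))))))
          | exact Or.inl (Or.inr (Or.inr (Or.inr (Or.inr (Or.inr (by omega))))))
          | exact Or.inr (Or.inl (by omega))
          | exact Or.inr (Or.inr (Or.inl (by omega)))
          | exact Or.inr (Or.inr (Or.inr (Or.inl (by omega))))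
          | exact Or.inr (Or.inr (Or.inr (Or.inr (Or.inl (by omega)))))
          | exact Or.inr (Or.inr (Or.inr (Or.inr (Or.inr (Or.inl (by omega))))))
          | exact Or.inr (Or.inr (Or.inr (Or.inr (Or.inr (Or.inr (by omega))))))

set_option maxHeartbeats 4000000 in
lemma deg26_t (m h s b c k : ℕ) (ok : OK26 m h s b c) (hk : 1 ≤ k) (hk' : k ≤ m - 2) :
    ({j : Fin (2 * m + 1) | A26 m h s b c (2 * m - k) j} : Set _).ncard = k + 1 := by
  unfold OK26 at ok
  by_cases hh : k ≤ h
  · rw [cnt26 (2 * m + 1) (fun j => A26 m h s b c (2 * m - k) j) 0 (k + 1) (k + 1) (k + 1)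
      (k + 1) (k + 1) (k + 1) (k + 1) (k + 1) (k + 1)]
    · omega
    · omega
    · intro j hj
      unfold A26 R26
      constructor
      · rintro ((h | h | h | h | h | h) | (h | h | h | h | h | h)) <;> omega
      · intro hint
        by_cases hj0 : j = 0 <;> by_cases hj1 : j = m + 1 <;> by_cases hj2 : j ≤ h <;>
          rcases hint with h | h | h | h | h
        all_goals
          first
            | exact Or.inl (Or.inl (by omega))
            | exact Or.inl (Or.inr (Or.inl (by omega)))
            | exact Or.inl (Or.inr (Or.inr (Or.inl (by omega))))
            | exact Or.inl (Or.inr (Or.inr (Or.inr (Or.inl (by omega)))))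
            | exact Or.inl (Or.inr (Or.inr (Or.inr (Or.inr (Or.inl (by omega))))))
            | exact Or.inl (Or.inr (Or.inr (Or.inr (Or.inr (Or.inr (by omega))))))
            | exact Or.inr (Or.inl (by omega))
            | exact Or.inr (Or.inr (Or.inl (by omega)))
            | exact Or.inr (Or.inr (Or.inr (Or.inl (by omega))))
            | exact Or.inr (Or.inr (Or.inr (Or.inr (Or.inl (by omega)))))
            | exact Or.inr (Or.inr (Or.inr (Or.inr (Or.inr (Or.inl (by omega))))))
            | exact Or.inr (Or.inr (Or.inr (Or.inr (Or.inr (Or.inr (by omega))))))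
  · rw [cnt26 (2 * m + 1) (fun j => A26 m h s b c (2 * m - k) j) 0 1 (m - k + 1) (m + 1)
      (m + 1) (m + 1) (m + 1) (m + 1) (m + 1) (m + 1)]
    · omega
    · omega
    · intro j hj
      unfold A26 R26
      constructor
      · rintro ((h | h | h | h | h | h) | (h | h | h | h | h | h)) <;> omega
      · intro hint
        by_cases hj0 : j = 0 <;> by_cases hj1 : j = m + 1 <;> by_cases hj2 : j ≤ h <;>
          rcases hint with h | h | h | h | h
        all_goals
          first
            | exact Or.inl (Or.inl (by omega))
            | exact Or.inl (Or.inr (Or.inl (by omega)))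
            | exact Or.inl (Or.inr (Or.inr (Or.inl (by omega))))
            | exact Or.inl (Or.inr (Or.inr (Or.inr (Or.inl (by omega)))))
            | exact Or.inl (Or.inr (Or.inr (Or.inr (Or.inr (Or.inl (by omega))))))
            | exact Or.inl (Or.inr (Or.inr (Or.inr (Or.inr (Or.inr (by omega))))))
            | exact Or.inr (Or.inl (by omega))
            | exact Or.inr (Or.inr (Or.inl (by omega)))
            | exact Or.inr (Or.inr (Or.inr (Or.inl (by omega))))
            | exact Or.inr (Or.inr (Or.inr (Or.inr (Or.inl (by omega)))))
            | exact Or.inr (Or.inr (Or.inr (Or.inr (Or.inr (Or.inl (by omega))))))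
            | exact Or.inr (Or.inr (Or.inr (Or.inr (Or.inr (Or.inr (by omega))))))

set_option maxHeartbeats 4000000 in
lemma deg26_w (m h s b c : ℕ) (ok : OK26 m h s b c) :
    ({j : Fin (2 * m + 1) | A26 m h s b c (2 * m) j} : Set _).ncard = c + 1 := by
  unfold OK26 at ok
  rw [cnt26 (2 * m + 1) (fun j => A26 m h s b c (2 * m) j) 0 c (m + 1) (m + 2) (m + 2) (m + 2)
    (m + 2) (m + 2) (m + 2) (m + 2)]
  · omega
  · omega
  · intro j hj
    unfold A26 R26
    constructor
    · rintro ((h | h | h | h | h | h) | (h | h | h | h | h | h)) <;> omega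
    · intro hint
      by_cases hj0 : j = 0 <;> by_cases hj1 : j = m + 1 <;> by_cases hj2 : j ≤ h <;>
        rcases hint with h | h | h | h | h
      all_goals
        first
          | exact Or.inl (Or.inl (by omega))
          | exact Or.inl (Or.inr (Or.inl (by omega)))
          | exact Or.inl (Or.inr (Or.inr (Or.inl (by omega))))
          | exact Or.inl (Or.inr (Or.inr (Or.inr (Or.inl (by omega)))))
          | exact Or.inl (Or.inr (Or.inr (Or.inr (Or.inr (Or.inl (by omega))))))
          | exact Or.inl (Or.inr (Or.inr (Or.inr (Or.inr (Or.inr (by omega))))))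
          | exact Or.inr (Or.inl (by omega))
          | exact Or.inr (Or.inr (Or.inl (by omega)))
          | exact Or.inr (Or.inr (Or.inr (Or.inl (by omega))))
          | exact Or.inr (Or.inr (Or.inr (Or.inr (Or.inl (by omega)))))
          | exact Or.inr (Or.inr (Or.inr (Or.inr (Or.inr (Or.inl (by omega))))))
          | exact Or.inr (Or.inr (Or.inr (Or.inr (Or.inr (Or.inr (by omega))))))

lemma walk26 {V : Type*} (G : SimpleGraph V) (f : ℕ → V) (k : ℕ)
    (hinj : ∀ x y, x ≤ k → y ≤ k → f x = f y → x = y)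
    (hadj : ∀ x, x < k → G.Adj (f (x + 1)) (f x)) :
    ∃ p : G.Walk (f k) (f 0), p.IsPath ∧ p.length = k ∧
      (∀ v ∈ p.support, ∃ x, x ≤ k ∧ v = f x) ∧
      ∀ e ∈ p.edges, ∃ x, x < k ∧ e = s(f (x + 1), f x) := by
  induction k with
  | zero => exact ⟨.nil, by simp, rfl, by simp, by simp⟩
  | succ k ih =>
    obtain ⟨p, hp, hl, hs, he⟩ := ih (fun x y hx hy => hinj x y (by omega) (by omega))
      (fun x hx => hadj x (by omega))
    refine ⟨.cons (hadj k (by omega)) p, ?_, by simp [hl], ?_, ?_⟩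
    · rw [SimpleGraph.Walk.cons_isPath_iff]
      refine ⟨hp, fun hmem => ?_⟩
      obtain ⟨x, hx, hfx⟩ := hs _ hmem
      have := hinj _ _ (le_refl _) (by omega) hfx
      omega
    · intro v hv
      rw [SimpleGraph.Walk.support_cons, List.mem_cons] at hv
      rcases hv with rfl | hv
      · exact ⟨k + 1, le_refl _, rfl⟩
      · obtain ⟨x, hx, h⟩ := hs v hv
        exact ⟨x, by omega, h⟩
    · intro e hv
      rw [SimpleGraph.Walk.edges_cons, List.mem_cons] at hv
      rcases hv with rfl | hv
      · exact ⟨k, by omega, rfl⟩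
      · obtain ⟨x, hx, h⟩ := he e hv
        exact ⟨x, by omega, h⟩

lemma cycle26 {V : Type*} (G : SimpleGraph V) (f : ℕ → V) (k : ℕ) (hk : 2 ≤ k)
    (hinj : ∀ x y, x ≤ k → y ≤ k → f x = f y → x = y)
    (hadj : ∀ x, x < k → G.Adj (f (x + 1)) (f x))
    (hlast : G.Adj (f 0) (f k)) : hasCycleOfLength G (k + 1) := by
  obtain ⟨p, hp, hl, -, he⟩ := walk26 G f k hinj hadj
  refine ⟨f 0, .cons hlast p, ?_, by simp [hl]⟩
  rw [SimpleGraph.Walk.cons_isCycle_iff]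
  refine ⟨hp, fun hmem => ?_⟩
  obtain ⟨x, hx, hh⟩ := he _ hmem
  rw [Sym2.eq_iff] at hh
  rcases hh with ⟨h1, h2⟩ | ⟨h1, h2⟩
  · have := hinj _ _ (by omega) (by omega) h1
    omega
  · have := hinj _ _ (by omega) (by omega) h1
    have := hinj _ _ (by omega) (by omega) h2
    omega

/-- the Hamiltonian cycle -/
def a26 (m h x : ℕ) : ℕ :=
  if x = 0 then 0 else if x = 1 then 2 * m - h else if x = 2 then h
  else if x + 2 * h ≤ 2 * m + 1 then
    (if x % 2 = 1 then m - (x - 3) / 2 else m + x / 2 - 1)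
  else (if x % 2 = 1 then m + (x - 1) / 2 else m - x / 2)

lemma a26_lt {m h s b c : ℕ} (ok : OK26 m h s b c) {x : ℕ} (hx : x < 2 * m) :
    a26 m h x < 2 * m := by
  unfold OK26 at ok
  unfold a26
  split_ifs <;> omega

/-- position on the Hamiltonian cycle -/
def p26 (m h v : ℕ) : ℕ :=
  if v = 0 then 0 else if v = 2 * m - h then 1 else if v = h then 2
  else if v < h then 2 * (m - v) else if v ≤ m then 3 + 2 * (m - v)
  else if v < 2 * m - h then 2 * (v - m) + 2 else 2 * (v - m) + 1

set_option maxHeartbeats 4000000 in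
lemma p26_a26 {m h s b c : ℕ} (ok : OK26 m h s b c) {x : ℕ} (hx : x < 2 * m) :
    p26 m h (a26 m h x) = x := by
  unfold OK26 at ok
  unfold a26
  split_ifs <;> unfold p26 <;> split_ifs <;> omega

lemma a26_inj {m h s b c : ℕ} (ok : OK26 m h s b c) {x y : ℕ} (hx : x < 2 * m) (hy : y < 2 * m)
    (hxy : a26 m h x = a26 m h y) : x = y := by
  rw [← p26_a26 ok hx, hxy, p26_a26 ok hy]

set_option maxHeartbeats 4000000 in
lemma a26_adj {m h s b c : ℕ} (ok : OK26 m h s b c) {x : ℕ} (hx : x + 1 < 2 * m) :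
    A26 m h s b c (a26 m h (x + 1)) (a26 m h x) := by
  unfold OK26 at ok
  obtain ⟨u, hu⟩ : ∃ u, u = a26 m h (x + 1) := ⟨_, rfl⟩
  obtain ⟨v, hv⟩ : ∃ v, v = a26 m h x := ⟨_, rfl⟩
  rw [← hu, ← hv]
  unfold a26 at hu hv
  by_cases hu1 : u = m + 1 <;> by_cases hv1 : v = m + 1 <;> split_ifs at hu hv
  all_goals first
    | contradiction
    | omega
    | exact Or.inl (Or.inl (by omega))
    | exact Or.inl (Or.inr (Or.inl (by omega)))
    | exact Or.inl (Or.inr (Or.inr (Or.inl (by omega))))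
    | exact Or.inl (Or.inr (Or.inr (Or.inr (Or.inl (by omega)))))
    | exact Or.inl (Or.inr (Or.inr (Or.inr (Or.inr (Or.inl (by omega))))))
    | exact Or.inl (Or.inr (Or.inr (Or.inr (Or.inr (Or.inr (by omega))))))
    | exact Or.inr (Or.inl (by omega))
    | exact Or.inr (Or.inr (Or.inl (by omega)))
    | exact Or.inr (Or.inr (Or.inr (Or.inl (by omega))))
    | exact Or.inr (Or.inr (Or.inr (Or.inr (Or.inl (by omega)))))
    | exact Or.inr (Or.inr (Or.inr (Or.inr (Or.inr (Or.inl (by omega))))))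
    | exact Or.inr (Or.inr (Or.inr (Or.inr (Or.inr (Or.inr (by omega))))))

lemma a26_v {m h s b c : ℕ} (ok : OK26 m h s b c) {x : ℕ} (hx : x < 2 * m)
    (hx' : x = 1 ∨ x = 2 ∨ (4 ≤ x ∧ x % 2 = 0 ∧ x + 2 * h ≤ 2 * m) ∨
      (x % 2 = 1 ∧ 2 * m + 3 ≤ x + 2 * h)) :
    A26 m h s b c 0 (a26 m h x) := by
  unfold OK26 at ok
  obtain ⟨v, hv⟩ : ∃ v, v = a26 m h x := ⟨_, rfl⟩
  rw [← hv]
  have hv' : v = h ∨ (m + 1 ≤ v ∧ v + 1 ≤ 2 * m) := by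
    unfold a26 at hv
    split_ifs at hv <;> omega
  exact Or.inl (Or.inl (by omega))

lemma a26_skip {m h s b c : ℕ} (ok : OK26 m h s b c) :
    A26 m h s b c (a26 m h 5) (a26 m h 2) := by
  unfold OK26 at ok
  have h5 : a26 m h 5 = m - 1 := by
    simp only [a26]
    norm_num
    omega
  have h2 : a26 m h 2 = h := by
    simp [a26]
  rw [h5, h2]
  exact Or.inr (Or.inr (Or.inl (by omega)))

lemma cyc26 {m h s b c : ℕ} (ok : OK26 m h s b c) (g : ℕ → ℕ) (r : ℕ) (hr : 3 ≤ r)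
    (hg0 : g 0 = 0)
    (hg : ∀ x, x < r → g x < 2 * m) (hginj : ∀ x y, x < r → y < r → g x = g y → x = y)
    (hstep : ∀ x, x + 1 < r → A26 m h s b c (a26 m h (g (x + 1))) (a26 m h (g x)))
    (hlast : A26 m h s b c 0 (a26 m h (g (r - 1)))) (S : Set (Fin (2 * m + 1)))
    (hS : ∀ i : Fin (2 * m + 1), (i : ℕ) < 2 * m → i ∈ S) :
    hasCycleOfLength ((G26 m h s b c ok).induce S) r := by
  have hm : 0 < 2 * m := by unfold OK26 at ok; omega
  have hlt : ∀ x, x < r → a26 m h (g x) < 2 * m := fun x hx => a26_lt ok (hg x hx)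
  let f : ℕ → S := fun x => if hx : x < r then
    ⟨⟨a26 m h (g x), by have := hlt x hx; omega⟩, hS _ (hlt x hx)⟩ else
    ⟨⟨0, by omega⟩, hS _ hm⟩
  have hf : ∀ x, x < r → ((f x : Fin (2 * m + 1)) : ℕ) = a26 m h (g x) := by
    intro x hx
    simp [f, hx]
  have key := cycle26 ((G26 m h s b c ok).induce S) f (r - 1) (by omega) ?_ ?_ ?_
  · rwa [show r - 1 + 1 = r by omega] at key
  · intro x y hx hy hxy
    have h1 : a26 m h (g x) = a26 m h (g y) := by
      rw [← hf x (by omega), ← hf y (by omega), hxy]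
    exact hginj x y (by omega) (by omega)
      (a26_inj ok (hg x (by omega)) (hg y (by omega)) h1)
  · intro x hx
    rw [SimpleGraph.comap_adj]
    change A26 m h s b c ((f (x + 1) : Fin (2 * m + 1)) : ℕ) ((f x : Fin (2 * m + 1)) : ℕ)
    rw [hf _ (by omega), hf _ (by omega)]
    exact hstep x (by omega)
  · rw [SimpleGraph.comap_adj]
    change A26 m h s b c ((f 0 : Fin (2 * m + 1)) : ℕ) ((f (r - 1) : Fin (2 * m + 1)) : ℕ)
    rw [hf _ (by omega), hf _ (by omega), hg0]
    exact hlast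

lemma allcyc26 {m h s b c : ℕ} (ok : OK26 m h s b c) (S : Set (Fin (2 * m + 1)))
    (hS : ∀ i : Fin (2 * m + 1), (i : ℕ) < 2 * m → i ∈ S) (r : ℕ) (hr : 3 ≤ r)
    (hr' : r ≤ 2 * m) :
    hasCycleOfLength ((G26 m h s b c ok).induce S) r := by
  have ok' := ok
  unfold OK26 at ok'
  by_cases h1 : r = 3 ∨ (r % 2 = 1 ∧ r + 2 * h ≤ 2 * m + 1) ∨
      (r % 2 = 0 ∧ 2 * m + 4 ≤ r + 2 * h)
  · exact cyc26 ok (fun x => x) r hr rfl (fun x hx => by omega) (fun x y _ _ h => h)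
      (fun x hx => a26_adj ok (by omega)) (a26_v ok (by omega) (by omega)) S hS
  by_cases h2 : r + 2 * h = 2 * m + 2
  · refine cyc26 ok (fun x => if x ≤ 2 then x else x + 2) r hr rfl (fun x hx => ?_)
      (fun x y _ _ h => ?_) (fun x hx => ?_) (a26_v ok ?_ ?_) S hS
    · try dsimp only
      split_ifs <;> omega
    · try dsimp only at h
      split_ifs at h <;> omega
    · try dsimp only
      by_cases hx2 : x = 2
      · subst hx2
        exact a26_skip ok
      · by_cases hx3 : x ≤ 1
        · rw [if_pos (by omega), if_pos (by omega)]
          exact a26_adj ok (by omega)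
        · rw [if_neg (by omega), if_neg (by omega)]
          exact a26_adj (x := x + 2) ok (by omega)
    · rw [if_neg (by omega)]
      omega
    · rw [if_neg (by omega)]
      omega
  · refine cyc26 ok (fun x => if x = 0 then 0 else x + 1) r hr rfl (fun x hx => ?_)
      (fun x y _ _ h => ?_) (fun x hx => ?_) (a26_v ok ?_ ?_) S hS
    · try dsimp only
      split_ifs <;> omega
    · try dsimp only at h
      split_ifs at h <;> omega
    · try dsimp only
      by_cases hx0 : x = 0
      · subst hx0
        exact Or.symm (a26_v (x := 2) ok (by omega) (by omega))
      · rw [if_neg (by omega), if_neg (by omega)]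
        exact a26_adj (x := x + 1) ok (by omega)
    · rw [if_neg (by omega)]
      omega
    · rw [if_neg (by omega)]
      omega

lemma seq26 (m : ℕ) (hm : 5 ≤ m) (e c : ℕ) (he : e + 1 ≤ m) (hc : c ≤ 1)
    (hpar : (e + (m - m / 2)) % 2 = 0) :
    ∃ (h s b : ℕ) (ok : OK26 m h s b c), ∀ d : Fin (2 * m + 1) → ℕ,
    (∀ i : ℕ, ∀ _ : 2 ≤ i, ∀ _ : i ≤ m + 2, d ⟨i - 1, by omega⟩ = m) →
    (∀ i : ℕ, ∀ _ : 1 ≤ i, ∀ _ : i ≤ m - 2, d ⟨2 * m - i, by omega⟩ = i + 1) →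
    d ⟨2 * m, by omega⟩ = c + 1 → d ⟨0, by omega⟩ = m + e + c →
    IsDegreeSeq (G26 m h s b c ok) d := by
  obtain ⟨h, s, b, ok, hv⟩ : ∃ h s b : ℕ, OK26 m h s b c ∧
      (if b = 1 then 2 * m - h + 2 * s + c else 2 * m - h - 2 * s + c) = m + e + c := by
    by_cases hep : e ≤ m - m / 2
    · refine ⟨m / 2, (m - m / 2 - e) / 2, 0, ?_, ?_⟩
      · unfold OK26
        omega
      · rw [if_neg (by omega)]
        omega
    · refine ⟨m / 2, (e - (m - m / 2)) / 2, 1, ?_, ?_⟩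
      · unfold OK26
        omega
      · rw [if_pos rfl]
        omega
  refine ⟨h, s, b, ok, fun d hmid htail hlast hfirst => ?_⟩
  rintro ⟨i, hi⟩
  change ({j : Fin (2 * m + 1) | A26 m h s b c i j} : Set _).ncard = _
  by_cases h0 : i = 0
  · subst h0
    rw [deg26_v m h s b c ok, hv]
    exact hfirst.symm
  by_cases h1 : i ≤ m + 1
  · have hd := hmid (i + 1) (by omega) (by omega)
    simp only [Nat.add_sub_cancel] at hd
    rw [hd]
    by_cases h2 : i ≤ h
    · exact deg26_Q m h s b c i ok (by omega) h2
    by_cases h3 : i ≤ m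
    · exact deg26_P m h s b c i ok (by omega) h3
    · obtain rfl : i = m + 1 := by omega
      exact deg26_t' m h s b c ok
  by_cases h2 : i = 2 * m
  · subst h2
    rw [hlast]
    exact deg26_w m h s b c ok
  · obtain ⟨k, rfl⟩ : ∃ k, i = 2 * m - k := ⟨2 * m - i, by omega⟩
    rw [htail k (by omega) (by omega)]
    exact deg26_t m h s b c k ok (by omega) (by omega)

lemma even26 {n : ℕ} (d : Fin n → ℕ) (hd : Graphic d) : (∑ i, d i) % 2 = 0 := by
  classical
  obtain ⟨G, hG⟩ := hd
  have h1 : ∑ i, d i = ∑ i, G.degree i := by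
    refine Finset.sum_congr rfl fun i _ => ?_
    rw [← hG i, Set.ncard_eq_toFinset_card']
    rfl
  rw [h1, G.sum_degrees_eq_twice_card_edges]
  omega

/-- **Lemma 2.6.** Let `m ≥ 5` and let `π = (d₁,…,d_{2m+1})` be a non-increasing graphic
sequence with `dᵢ = m` for `2 ≤ i ≤ m+2` and `d_{2m+1-i} = i+1` for `1 ≤ i ≤ m-2`. If
`d_{2m+1} = 2` and `d₁ ≥ m+1`, or if `d_{2m+1} = 1` and `d₁ = m`, then `π` has a
realization containing `C₃, …, C_{2m}` on those vertices with degrees `d₁, …, d_{2m}`. -/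
theorem lemma26 (m : ℕ) (hm : 5 ≤ m) (d : Fin (2 * m + 1) → ℕ)
    (hanti : Antitone d) (hgr : Graphic d)
    (hmid : ∀ i : ℕ, ∀ _ : 2 ≤ i, ∀ _ : i ≤ m + 2, d ⟨i - 1, by omega⟩ = m)
    (htail : ∀ i : ℕ, ∀ _ : 1 ≤ i, ∀ _ : i ≤ m - 2, d ⟨2 * m - i, by omega⟩ = i + 1)
    (hcase : (d ⟨2 * m, by omega⟩ = 2 ∧ m + 1 ≤ d ⟨0, by omega⟩) ∨
             (d ⟨2 * m, by omega⟩ = 1 ∧ d ⟨0, by omega⟩ = m)) :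
    RealizationWithCyclesOn (2 * m) d := by
  have hd0 : d ⟨0, by omega⟩ ≤ 2 * m := by
    obtain ⟨G, hG⟩ := hgr
    classical
    rw [← hG, Set.ncard_eq_toFinset_card']
    have := G.degree_lt_card_verts ⟨0, by omega⟩
    rw [Fintype.card_fin] at this
    exact Nat.lt_succ_iff.1 this
  obtain ⟨c, e, hc, he, hl, hf, hgap⟩ : ∃ c e : ℕ, c ≤ 1 ∧ e + 1 ≤ m ∧ d ⟨2 * m, by omega⟩ = c + 1 ∧
      d ⟨0, by omega⟩ = m + e + c ∧ True := by
    rcases hcase with ⟨h1, h2⟩ | ⟨h1, h2⟩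
    · exact ⟨1, d ⟨0, by omega⟩ - m - 1, by omega, by omega, by omega, by omega, trivial⟩
    · exact ⟨0, 0, by omega, by omega, by omega, by omega, trivial⟩
  have hpar : (e + (m - m / 2)) % 2 = 0 := by
    by_contra hne
    obtain ⟨e', he', hee⟩ : ∃ e', e' + 1 ≤ m ∧ (e' = e + 1 ∨ e = e' + 1) := by
      by_cases h0 : e = 0
      · exact ⟨1, by omega, by omega⟩
      · exact ⟨e - 1, by omega, by omega⟩
    obtain ⟨h, s, b, ok, H⟩ := seq26 m hm e' c he' hc (by omega)
    have H1 := H (Function.update d 0 (m + e' + c)) ?_ ?_ ?_ ?_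
    · have e1 := even26 _ ⟨_, H1⟩
      have e2 := even26 _ hgr
      rw [Fin.sum_univ_succ] at e1 e2
      have hs : ∀ i : Fin (2 * m), Function.update d 0 (m + e' + c) i.succ = d i.succ :=
        fun i => Function.update_of_ne (Fin.succ_ne_zero i) _ _
      simp only [hs, Function.update_self] at e1
      have hf' : d 0 = m + e + c := hf
      omega
    · intro i h1 h2
      rw [Function.update_of_ne, hmid i h1 h2]
      rw [Ne, Fin.ext_iff]
      simp
      omega
    · intro i h1 h2
      rw [Function.update_of_ne, htail i h1 h2]
      rw [Ne, Fin.ext_iff]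
      simp
      omega
    · rw [Function.update_of_ne, hl]
      rw [Ne, Fin.ext_iff]
      simp
      omega
    · exact Function.update_self _ _ _
  obtain ⟨h, s, b, ok, H⟩ := seq26 m hm e c he hc hpar
  refine ⟨G26 m h s b c ok, Finset.univ.filter (fun i : Fin (2 * m + 1) => (i : ℕ) < 2 * m),
    H d hmid htail hl hf, ?_, rfl, ?_⟩
  · rw [Fin.card_filter_val_lt]
    omega
  · intro r h3 hr
    exact allcyc26 ok _ (fun i hi => by simpa using hi) r h3 hr
end

section
/- Let m ≥ 5, n ≥ 2m+1, and let π = (d_1, …, d_n) be a non-increasing graphic sequence with m−1 ≥ d_n ≥ 1, d_{d_n − 1} ≥ m+1, d_{d_n} = ⋯ = d_{m+1} = m, and d_{2m+1−i} ≥ i+1 for 1 ≤ i ≤ m−1. If n ≥ 2m+2, let ω = (d_1−1, …, d_{d_n−1}−1, d_{d_n}, …, d_{n−2}, d_{n−1}−1), i.e., ω is obtained from π by deleting the term d_n and decreasing d_i by one for each i ∈ {1, …, d_n−1, n−1}. If n = 2m+1 and there exists an integer k with 1 ≤ k ≤ m−2 such that d_{2m+1−k} ≥ k+2 (with k chosen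 minimum), let ω = (d_1−1, …, d_{d_n−1}−1, d_{d_n}, …, d_{2m−k}, d_{2m+1−k}−1, d_{2m+2−k}, …, d_{n−1}). Then ω is graphic. -/
open Finset in
open Classical in
/-- finset of neighbours -/
noncomputable def nbF {n : ℕ} (G : SimpleGraph (Fin n)) (i : Fin n) : Finset (Fin n) :=
  univ.filter (fun j => G.Adj i j)

theorem mem_nbF {n : ℕ} (G : SimpleGraph (Fin n)) (i j : Fin n) : j ∈ nbF G i ↔ G.Adj i j := by
  simp [nbF]

theorem ncard_nbF {n : ℕ} (G : SimpleGraph (Fin n)) (i : Fin n) :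
    (G.neighborSet i).ncard = (nbF G i).card := by
  rw [← Set.ncard_coe_finset]
  congr 1
  ext j
  simp [mem_nbF]

theorem isDegreeSeq_iff {n : ℕ} (G : SimpleGraph (Fin n)) (d : Fin n → ℕ) :
    IsDegreeSeq G d ↔ ∀ i, (nbF G i).card = d i := by
  simp [IsDegreeSeq, ncard_nbF]

/-- two-switch: remove `ab`, `ce`, add `ac`, `be`. -/
theorem two_switch {n : ℕ} (G : SimpleGraph (Fin n)) (a b c e : Fin n)
    (hab : G.Adj a b) (hce : G.Adj c e) (hac : ¬ G.Adj a c) (hbe : ¬ G.Adj b e)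
    (nac : a ≠ c) (nbe : b ≠ e) :
    ∃ G' : SimpleGraph (Fin n), (∀ i, (nbF G' i).card = (nbF G i).card) ∧
      ∀ u w, G'.Adj u w ↔ ((G.Adj u w ∧ s(u,w) ≠ s(a,b) ∧ s(u,w) ≠ s(c,e)) ∨
        s(u,w) = s(a,c) ∨ s(u,w) = s(b,e)) := by
  classical
  have nab := hab.ne
  have nce := hce.ne
  have nae : a ≠ e := by rintro rfl; exact hac hce.symm
  have nbc : b ≠ c := by rintro rfl; exact hac hab
  have key : ∀ u w x y : Fin n, s(u,w) = s(x,y) ↔ (u = x ∧ w = y ∨ u = y ∧ w = x) := by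
    intro u w x y; simp
  let G' : SimpleGraph (Fin n) :=
    { Adj := fun u w => ((G.Adj u w ∧ s(u,w) ≠ s(a,b) ∧ s(u,w) ≠ s(c,e)) ∨
        s(u,w) = s(a,c) ∨ s(u,w) = s(b,e))
      symm := ⟨by
        intro u w h
        rw [Sym2.eq_swap, G.adj_comm]
        exact h⟩
      loopless := ⟨by
        intro u h
        simp only [key] at h
        have := G.irrefl (v := u)
        grind⟩ }
  refine ⟨G', ?_, fun u w => Iff.rfl⟩
  have swapc : ∀ (S S' : Finset (Fin n)) (r q : Fin n), r ∈ S → q ∉ S →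
      S' = insert q (S.erase r) → S'.card = S.card := by
    intro S S' r q hr hq h
    rw [h, Finset.card_insert_of_notMem (by simp [hq]), Finset.card_erase_add_one hr]
  have adj' : ∀ u w, G'.Adj u w ↔ ((G.Adj u w ∧ s(u,w) ≠ s(a,b) ∧ s(u,w) ≠ s(c,e)) ∨
        s(u,w) = s(a,c) ∨ s(u,w) = s(b,e)) := fun u w => Iff.rfl
  simp only [key] at adj'
  intro i
  by_cases h1 : i = a
  · subst h1
    refine swapc _ _ b c (by simpa [mem_nbF]) (by simpa [mem_nbF]) ?_
    ext j; simp only [mem_nbF, adj', Finset.mem_insert, Finset.mem_erase]; grind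
  by_cases h2 : i = b
  · subst h2
    refine swapc _ _ a e (by simpa [mem_nbF] using hab.symm) (by simpa [mem_nbF]) ?_
    ext j; simp only [mem_nbF, adj', Finset.mem_insert, Finset.mem_erase]; grind
  by_cases h3 : i = c
  · subst h3
    refine swapc _ _ e a (by simpa [mem_nbF]) (by simpa [mem_nbF, G.adj_comm] using hac) ?_
    ext j; simp only [mem_nbF, adj', Finset.mem_insert, Finset.mem_erase]; grind
  by_cases h4 : i = e
  · subst h4
    refine swapc _ _ c b (by simpa [mem_nbF] using hce.symm)
      (by simpa [mem_nbF, G.adj_comm] using hbe) ?_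
    ext j; simp only [mem_nbF, adj', Finset.mem_insert, Finset.mem_erase]; grind
  congr 1
  ext j; simp only [mem_nbF, adj']; grind

/-- one exchange step at `p`. -/
theorem one_step {n : ℕ} (G : SimpleGraph (Fin n)) (T : Finset (Fin n)) (p v x y : Fin n)
    (hv : v ∉ T) (hx : x ∈ T) (hpx : p ≠ x) (hpv : G.Adj p v) (hnpx : ¬ G.Adj p x)
    (hxy : G.Adj x y) (hyv : y ≠ v) (hnvy : ¬ G.Adj v y) :
    ∃ G' : SimpleGraph (Fin n), (∀ i, (nbF G' i).card = (nbF G i).card) ∧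
      (nbF G p ∩ T).card < (nbF G' p ∩ T).card := by
  obtain ⟨G', h1, h2⟩ := two_switch G v p y x hpv.symm hxy.symm hnvy hnpx hyv.symm hpx
  refine ⟨G', h1, Finset.card_lt_card ?_⟩
  have hvp := hpv.ne
  have hyp : y ≠ p := by rintro rfl; exact hnpx hxy.symm
  have hvx : v ≠ x := by rintro rfl; exact hv hx
  rw [Finset.ssubset_iff_of_subset]
  · exact ⟨x, by simp [mem_nbF, h2, hx], by simp [mem_nbF, hnpx]⟩
  · intro j
    simp only [Finset.mem_inter, mem_nbF, h2]
    rintro ⟨hj, hjT⟩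
    refine ⟨?_, hjT⟩
    have : j ≠ v := by rintro rfl; exact hv hjT
    simp
    grind

theorem improve {n : ℕ} (m : ℕ) (hm : 1 ≤ m) (d : Fin n → ℕ) (p x : Fin n) (H L : Finset (Fin n))
    (hxH : x ∉ H) (hpH : p ∉ H) (hpx : p ≠ x) (hcard : d p = H.card + 1)
    (hH : ∀ i ∈ H, m + 1 ≤ d i) (hH' : ∀ i, i ∉ H → d i ≤ m) (hmin : ∀ i, d p ≤ d i)
    (hL : m + 2 ≤ L.card) (hpL : p ∉ L) (hLd : ∀ i ∈ L, m ≤ d i)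
    (G : SimpleGraph (Fin n)) (hG : ∀ i, (nbF G i).card = d i) (hne : nbF G p ≠ insert x H) :
    ∃ G' : SimpleGraph (Fin n), (∀ i, (nbF G' i).card = d i) ∧
      (nbF G p ∩ insert x H).card < (nbF G' p ∩ insert x H).card := by
  classical
  have hT : (insert x H).card = H.card + 1 := Finset.card_insert_of_notMem hxH
  have hnp : (nbF G p).card = H.card + 1 := by rw [hG, hcard]
  obtain ⟨v, hvp, hvT⟩ : ∃ v ∈ nbF G p, v ∉ insert x H := by
    by_contra! h
    exact hne (Finset.eq_of_subset_of_card_le h (by omega))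
  have hpv : G.Adj p v := (mem_nbF ..).1 hvp
  have hvH : v ∉ H := fun h => hvT (Finset.mem_insert_of_mem h)
  have hvx : v ≠ x := by rintro rfl; simp at hvT
  have hdv := hH' v hvH
  have step : ∀ (G₁ : SimpleGraph (Fin n)), (∀ i, (nbF G₁ i).card = d i) →
      (∀ w, G₁.Adj p w ↔ G.Adj p w) → ∀ u ∈ insert x H, p ≠ u → ¬ G.Adj p u →
      ∀ y, G₁.Adj u y → y ≠ v → ¬ G₁.Adj v y →
      ∃ G' : SimpleGraph (Fin n), (∀ i, (nbF G' i).card = d i) ∧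
      (nbF G p ∩ insert x H).card < (nbF G' p ∩ insert x H).card := by
    intro G₁ hG₁ hp u hu hpu hnu y huy hyv hvy
    obtain ⟨G', h1, h2⟩ := one_step G₁ (insert x H) p v u y hvT hu hpu ((hp v).2 hpv)
      (fun h => hnu ((hp u).1 h)) huy hyv hvy
    refine ⟨G', fun i => (h1 i).trans (hG₁ i), ?_⟩
    have : nbF G₁ p = nbF G p := by ext w; simp [mem_nbF, hp]
    rwa [this] at h2
  have hpv' : p ∈ nbF G v := (mem_nbF ..).2 hpv.symm
  have hce : ((nbF G v).erase p).card + 1 = d v := by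
    rw [Finset.card_erase_add_one hpv', hG]
  by_cases hc : ∃ u ∈ H, ¬ G.Adj p u
  · obtain ⟨u, hu, hnu⟩ := hc
    obtain ⟨y, hy, hy'⟩ : ∃ y ∈ nbF G u, y ∉ insert v ((nbF G v).erase p) := by
      by_contra! h
      have h1 := Finset.card_le_card (show nbF G u ⊆ _ from h)
      have h2 := Finset.card_insert_le v ((nbF G v).erase p)
      have h3 := hG u
      have h4 := hH u hu
      omega
    simp only [mem_nbF, Finset.mem_insert, Finset.mem_erase] at hy hy'
    have hyp : y ≠ p := by rintro rfl; exact hnu hy.symm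
    exact step G hG (fun _ => Iff.rfl) u (Finset.mem_insert_of_mem hu)
      (by rintro rfl; exact hpH hu) hnu y hy (by tauto) (by tauto)
  push Not at hc
  have hNp : nbF G p = insert v H := by
    symm
    apply Finset.eq_of_subset_of_card_le
    · intro j hj
      rcases Finset.mem_insert.1 hj with rfl | hj
      · exact hvp
      · exact (mem_nbF ..).2 (hc j hj)
    · rw [Finset.card_insert_of_notMem hvH, hnp]
  have hpadj : ∀ j, G.Adj p j ↔ (j = v ∨ j ∈ H) := by
    intro j; rw [← mem_nbF, hNp, Finset.mem_insert]
  have hnpx : ¬ G.Adj p x := by rw [hpadj]; tauto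
  by_cases hs : ∃ y, G.Adj x y ∧ y ≠ v ∧ ¬ G.Adj v y
  · obtain ⟨y, h1, h2, h3⟩ := hs
    exact step G hG (fun _ => Iff.rfl) x (Finset.mem_insert_self ..) hpx hnpx y h1 h2 h3
  push Not at hs
  obtain ⟨y, hy, hyH⟩ : ∃ y ∈ nbF G x, y ∉ H := by
    by_contra! h
    have h1 := Finset.card_le_card (show nbF G x ⊆ _ from h)
    have h2 := hmin x
    have h3 := hG x
    omega
  have hxy : G.Adj x y := (mem_nbF ..).1 hy
  have hyp : y ≠ p := by rintro rfl; exact hnpx hxy.symm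
  have hdy := hH' y hyH
  obtain ⟨a, ha, ha'⟩ : ∃ a ∈ (L.erase v).erase x, a ∉ (nbF G v).erase p := by
    by_contra! h
    have h1 := Finset.card_le_card (show (L.erase v).erase x ⊆ _ from h)
    have h2 := Finset.pred_card_le_card_erase (s := L.erase v) (a := x)
    have h3 := Finset.pred_card_le_card_erase (s := L) (a := v)
    omega
  simp only [mem_nbF, Finset.mem_erase] at ha ha'
  obtain ⟨hax, hav, haL⟩ := ha
  have hap : a ≠ p := by rintro rfl; exact hpL haL
  have hnva : ¬ G.Adj v a := by tauto
  have hnxa : ¬ G.Adj x a := fun h => hnva (hs a h hav)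
  have hay : a ≠ y := by rintro rfl; exact hnxa hxy
  have hda : m ≤ ((nbF G a).erase p).card := by
    by_cases haH : a ∈ H
    · have h1 := Finset.pred_card_le_card_erase (s := nbF G a) (a := p)
      have h2 := hG a
      have h3 := hH a haH
      omega
    · rw [Finset.erase_eq_of_notMem, hG]
      · exact hLd a haL
      · rw [mem_nbF, G.adj_comm, hpadj]; tauto
  obtain ⟨b, hb, hby, hnyb⟩ : ∃ b ∈ (nbF G a).erase p, b ≠ y ∧ ¬ G.Adj y b := by
    by_contra! h
    by_cases hyv : y = v
    · subst hyv
      have : (nbF G a).erase p ⊆ (nbF G y).erase p := by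
        intro b hb
        have hb2 := h b hb
        simp only [mem_nbF, Finset.mem_erase] at hb ⊢
        refine ⟨hb.1, hb2 ?_⟩
        rintro rfl
        exact hnva hb.2.symm
      have := Finset.card_le_card this
      omega
    have hvy : v ∈ nbF G y := (mem_nbF ..).2 (hs y hxy hyv).symm
    have hyc := Finset.card_erase_add_one hvy
    rw [hG] at hyc
    by_cases hya : G.Adj y a
    · have hsub : (nbF G a).erase p ⊆ insert y (((nbF G y).erase v).erase a) := by
        intro b hb
        have hb2 := h b hb
        simp only [mem_nbF, Finset.mem_erase, Finset.mem_insert] at hb ⊢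
        by_cases hby : b = y
        · exact Or.inl hby
        · refine Or.inr ⟨hb.2.ne', ?_, hb2 hby⟩
          rintro rfl
          exact hnva hb.2.symm
      have h1 := Finset.card_le_card hsub
      have h2 := Finset.card_insert_le y (((nbF G y).erase v).erase a)
      have h3 := Finset.card_erase_add_one (s := (nbF G y).erase v) (a := a)
        (by simp [mem_nbF, hav, hya])
      omega
    · have hsub : (nbF G a).erase p ⊆ (nbF G y).erase v := by
        intro b hb
        have hb2 := h b hb
        simp only [mem_nbF, Finset.mem_erase] at hb ⊢
        constructor
        · rintro rfl
          exact hnva hb.2.symm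
        · apply hb2
          rintro rfl
          exact hya hb.2.symm
      have h1 := Finset.card_le_card hsub
      omega
  simp only [mem_nbF, Finset.mem_erase] at hb
  obtain ⟨hbp, hab⟩ := hb
  obtain ⟨G₁, h1, h2⟩ := two_switch G x y a b hxy hab hnxa hnyb hax.symm hby.symm
  have nab := hab.ne
  refine step G₁ (fun i => (h1 i).trans (hG i)) ?_ x (Finset.mem_insert_self ..) hpx hnpx a
    ?_ hav ?_
  · intro w
    rw [h2]
    simp
    grind
  · rw [h2]; simp
  · rw [h2]
    simp
    grind

theorem exists_good {n : ℕ} (m : ℕ) (hm : 1 ≤ m) (d : Fin n → ℕ) (p x : Fin n)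
    (H L : Finset (Fin n))
    (hxH : x ∉ H) (hpH : p ∉ H) (hpx : p ≠ x) (hcard : d p = H.card + 1)
    (hH : ∀ i ∈ H, m + 1 ≤ d i) (hH' : ∀ i, i ∉ H → d i ≤ m) (hmin : ∀ i, d p ≤ d i)
    (hL : m + 2 ≤ L.card) (hpL : p ∉ L) (hLd : ∀ i ∈ L, m ≤ d i) (hgr : Graphic d) :
    ∃ G : SimpleGraph (Fin n), (∀ i, (nbF G i).card = d i) ∧ nbF G p = insert x H := by
  obtain ⟨G, hG⟩ := hgr
  rw [isDegreeSeq_iff] at hG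
  obtain ⟨k, hk⟩ : ∃ k, k = (insert x H).card - (nbF G p ∩ insert x H).card := ⟨_, rfl⟩
  induction k using Nat.strong_induction_on generalizing G with
  | _ k ih =>
    by_cases h : nbF G p = insert x H
    · exact ⟨G, hG, h⟩
    · obtain ⟨G', h1, h2⟩ := improve m hm d p x H L hxH hpH hpx hcard hH hH' hmin hL hpL hLd G hG h
      have h3 := Finset.card_le_card (Finset.inter_subset_right (s₁ := nbF G' p) (s₂ := insert x H))
      exact ih _ (by omega) G' h1 rfl

theorem lemma23_core (m n : ℕ) (hm : 5 ≤ m) (hn : 2 * m + 1 ≤ n) (d : Fin n → ℕ) (D : ℕ → ℕ)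
    (hD : ∀ i : Fin n, d i = D i)
    (hanti : Antitone d) (hgr : Graphic d)
    (dn : ℕ) (hdn_def : dn = D (n - 1))
    (hdn_ub : dn ≤ m - 1) (hdn_lb : 1 ≤ dn)
    (hbig : 2 ≤ dn → m + 1 ≤ D (dn - 2))
    (hmid : D (dn - 1) = m)
    (hposa : m ≤ D (m + 1))
    (x : ℕ) (hx1 : m ≤ x) (hx2 : x < n - 1) :
    Graphic (fun j : Fin (n - 1) =>
        if (j : ℕ) + 1 ≤ dn - 1 ∨ (j : ℕ) = x then D j - 1 else D j) := by
  have hanti' : ∀ i j : ℕ, i ≤ j → j < n → D j ≤ D i := by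
    intro i j hij hj
    have h := hanti (show (⟨i, lt_of_le_of_lt hij hj⟩ : Fin n) ≤ ⟨j, hj⟩ from hij)
    rwa [hD, hD] at h
  classical
  have cardlt : ∀ k ≤ n, (Finset.univ.filter (fun i : Fin n => (i : ℕ) < k)).card = k := by
    intro k hk
    rw [Fin.card_filter_val_lt]; omega
  obtain ⟨G, hG, hGp⟩ := exists_good m (by omega) d ⟨n - 1, by omega⟩ ⟨x, by omega⟩
    (Finset.univ.filter (fun i : Fin n => (i : ℕ) < dn - 1))
    (Finset.univ.filter (fun i : Fin n => (i : ℕ) < m + 2))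
    (by simp; omega) (by simp; omega) (by simp; omega)
    (by rw [cardlt _ (by omega), hD, ← hdn_def]; omega)
    (by
      intro i hi
      simp only [Finset.mem_filter, Finset.mem_univ, true_and] at hi
      rw [hD]
      exact (hbig (by omega)).trans (hanti' _ _ (by omega) (by omega)))
    (by
      intro i hi
      simp only [Finset.mem_filter, Finset.mem_univ, true_and] at hi
      rw [← hmid, hD]
      exact hanti' _ _ (by omega) (by omega))
    (by
      intro i
      rw [hD, hD]
      exact hanti' _ _ (by simp only; omega) (by simp only; omega))
    (by rw [cardlt _ (by omega)])
    (by simp; omega)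
    (by
      intro i hi
      simp only [Finset.mem_filter, Finset.mem_univ, true_and] at hi
      rw [hD]
      exact hposa.trans (hanti' _ _ (by omega) (by omega)))
    hgr
  let f : Fin (n - 1) ↪ Fin n := ⟨fun j => ⟨j, by omega⟩, by
    intro i j h; simpa [Fin.ext_iff] using h⟩
  have hf : ∀ j, f j = ⟨j, by omega⟩ := fun j => rfl
  refine ⟨G.comap f, (isDegreeSeq_iff _ _).2 ?_⟩
  intro j
  have hmap : (nbF (G.comap f) j).map f = (nbF G (f j)).erase ⟨n - 1, by omega⟩ := by
    ext w
    simp only [Finset.mem_map, mem_nbF, Finset.mem_erase, SimpleGraph.comap_adj]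
    constructor
    · rintro ⟨a, ha, rfl⟩
      refine ⟨?_, ha⟩
      rw [hf, Ne, Fin.mk.injEq]; omega
    · rintro ⟨h1, h2⟩
      rw [Ne, Fin.ext_iff] at h1
      simp only at h1
      exact ⟨⟨w, by omega⟩, h2, rfl⟩
  rw [← Finset.card_map f, hmap]
  have hiff : (⟨n - 1, by omega⟩ : Fin n) ∈ nbF G (f j) ↔ ((j : ℕ) + 1 ≤ dn - 1 ∨ (j : ℕ) = x) := by
    rw [mem_nbF, G.adj_comm, ← mem_nbF, hGp]
    simp only [hf, Finset.mem_insert, Finset.mem_filter, Finset.mem_univ, true_and, Fin.mk.injEq]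
    omega
  split_ifs with hc
  · rw [Finset.card_erase_of_mem (hiff.2 hc), hG, hD, hf]
  · rw [Finset.erase_eq_of_notMem (fun h => hc (hiff.1 h)), hG, hD, hf]

/-- **Lemma 2.3.** Let `m ≥ 5`, `n ≥ 2m+1` and `π = (d₁,…,dₙ)` be a non-increasing
graphic sequence with `m-1 ≥ dₙ ≥ 1`, `d_{dₙ-1} ≥ m+1`, `d_{dₙ} = ⋯ = d_{m+1} = m` and
`d_{2m+1-i} ≥ i+1` for `1 ≤ i ≤ m-1`. If `n ≥ 2m+2`, the sequence `ω` obtained from `π`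
by deleting `dₙ` and decreasing `dᵢ` by one for `i ∈ {1,…,dₙ-1, n-1}` is graphic; if
`n = 2m+1` and `k` (`1 ≤ k ≤ m-2`) is minimal with `d_{2m+1-k} ≥ k+2`, the sequence `ω`
obtained from `π` by deleting `dₙ` and decreasing `dᵢ` by one for
`i ∈ {1,…,dₙ-1, 2m+1-k}` is graphic. -/
theorem lemma23 (m n : ℕ) (hm : 5 ≤ m) (hn : 2 * m + 1 ≤ n) (d : Fin n → ℕ)
    (hanti : Antitone d) (hgr : Graphic d)
    (dn : ℕ) (hdn_def : dn = d ⟨n - 1, by omega⟩)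
    (hdn_ub : dn ≤ m - 1) (hdn_lb : 1 ≤ dn)
    (hbig : ∀ _ : 2 ≤ dn, m + 1 ≤ d ⟨dn - 2, by omega⟩)
    (hmid : ∀ i : ℕ, ∀ _ : dn ≤ i, ∀ _ : 1 ≤ i, ∀ _ : i ≤ m + 1, d ⟨i - 1, by omega⟩ = m)
    (hposa : ∀ i : ℕ, ∀ _ : 1 ≤ i, ∀ _ : i ≤ m - 1, i + 1 ≤ d ⟨2 * m - i, by omega⟩) :
    (2 * m + 2 ≤ n →
      Graphic (fun j : Fin (n - 1) =>
        if (j : ℕ) + 1 ≤ dn - 1 ∨ (j : ℕ) = n - 2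
        then d ⟨(j : ℕ), by omega⟩ - 1 else d ⟨(j : ℕ), by omega⟩)) ∧
    (n = 2 * m + 1 →
      ∀ k : ℕ, ∀ _ : 1 ≤ k, ∀ _ : k ≤ m - 2,
        ∀ _ : k + 2 ≤ d ⟨2 * m - k, by omega⟩,
        ∀ _ : (∀ k' : ℕ, ∀ _ : 1 ≤ k', ∀ _ : k' < k, d ⟨2 * m - k', by omega⟩ < k' + 2),
        Graphic (fun j : Fin (n - 1) =>
          if (j : ℕ) + 1 ≤ dn - 1 ∨ (j : ℕ) = 2 * m - k
          then d ⟨(j : ℕ), by omega⟩ - 1 else d ⟨(j : ℕ), by omega⟩)) := by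
  let D : ℕ → ℕ := fun j => if h : j < n then d ⟨j, h⟩ else 0
  have hD : ∀ j (h : j < n), D j = d ⟨j, h⟩ := fun j h => dif_pos h
  have core := lemma23_core m n hm hn d D (fun i => (hD i i.2).symm) hanti hgr dn
    (by rw [hD]; exact hdn_def) hdn_ub hdn_lb
    (by intro h; rw [hD]; exact hbig h)
    (by rw [hD]; exact hmid dn le_rfl hdn_lb (by omega))
    (by
      have h := hposa (m - 1) (by omega) (by omega)
      rw [← hD] at h
      have e : 2 * m - (m - 1) = m + 1 := by omega
      rw [e] at h
      omega)
  refine ⟨fun h => ?_, fun h k hk1 hk2 _ _ => ?_⟩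
  · convert core (n - 2) (by omega) (by omega) using 4 <;> rw [hD]
  · convert core (2 * m - k) (by omega) (by omega) using 4 <;> rw [hD]
end

section
/- Let m ≥ 5, n ≥ 2m+1, and let π = (d_1, …, d_n) be a non-increasing graphic sequence with m−1 ≥ d_n ≥ 1, d_{d_n−1} = d_{d_n} = ⋯ = d_{m+2} = m, and d_{m+3} = ⋯ = d_{2m+1} = m−1. Let p = max{i : d_i ≥ m+1} (with p = 0 if no term is at least m+1). Define ρ as follows: if p = 0 and n ≥ 2m+3, ρ = (d_1, …, d_{m+3}, d_{m+4}−1, …, d_{2m}−1, d_{2m+2}−1, d_{2m+3}−1, d_{2m+4}, …, d_n); if p = 1 and n ≥ 2m+2, ρ = (d_1−1, d_2, …, d_{m+3}, d_{m+4}−1, …, d_{2m}−1, d_{2m+2}−1, d_{2m+3}, …, d_n); if p = 2, ρ = (d_1−1, d_2−1, d_3, …, d_{m+3}, d_{m+4}−1, …, d_{2m}−1, d_{2m+2}, …, d_n); if p ≥ 3, ρ = (d_1−1, …, d_p−1, d_{p+1}, …, d_{m+3}, d_{m+4}−1, …, d_{2m+2−p}−1, d_{2m+3−p}, …, d_{2m},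 d_{2m+2}, …, d_n). Then ρ is graphic. -/
namespace EG
open Finset Classical

noncomputable def dg {V : Type*} [Fintype V] (G : SimpleGraph V) (v : V) : ℕ :=
  (univ.filter (fun w => G.Adj v w)).card

def addE {V : Type*} (G : SimpleGraph V) (a b : V) : SimpleGraph V where
  Adj x y := G.Adj x y ∨ (a ≠ b ∧ ((x = a ∧ y = b) ∨ (x = b ∧ y = a)))
  symm := ⟨fun x y h => by
    rcases h with h | ⟨hab, h⟩
    · exact Or.inl h.symm
    · exact Or.inr ⟨hab, by tauto⟩⟩
  loopless := ⟨fun x h => by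
    rcases h with h | ⟨hab, ⟨h1, h2⟩ | ⟨h1, h2⟩⟩
    · exact G.loopless.irrefl x h
    · exact hab (h1.symm.trans h2)
    · exact hab (h2.symm.trans h1)⟩

def delE {V : Type*} (G : SimpleGraph V) (a b : V) : SimpleGraph V where
  Adj x y := G.Adj x y ∧ ¬ ((x = a ∧ y = b) ∨ (x = b ∧ y = a))
  symm := ⟨fun x y h => ⟨h.1.symm, by have := h.2; tauto⟩⟩
  loopless := ⟨fun x h => G.loopless.irrefl x h.1⟩

variable {V : Type*} [Fintype V]

lemma dg_addE (G : SimpleGraph V) {a b : V} (hab : a ≠ b) (h : ¬ G.Adj a b) (v : V) :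
    dg (addE G a b) v = dg G v + if v = a ∨ v = b then 1 else 0 := by
  have h' : ¬ G.Adj b a := fun k => h k.symm
  unfold dg
  by_cases hva : v = a
  · subst hva
    have : (univ.filter (fun w => (addE G v b).Adj v w)) =
        insert b (univ.filter (fun w => G.Adj v w)) := by
      ext w; simp only [addE, mem_filter, mem_univ, true_and, mem_insert]; tauto
    rw [this, card_insert_of_notMem (by simpa using h)]; simp
  by_cases hvb : v = b
  · subst hvb
    have : (univ.filter (fun w => (addE G a v).Adj v w)) =
        insert a (univ.filter (fun w => G.Adj v w)) := by
      ext w; simp only [addE, mem_filter, mem_univ, true_and, mem_insert]; tauto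
    rw [this, card_insert_of_notMem (by simpa using h')]; simp
  · have : (univ.filter (fun w => (addE G a b).Adj v w)) =
        (univ.filter (fun w => G.Adj v w)) := by
      ext w; simp [addE, hva, hvb]
    rw [this]; simp [hva, hvb]

lemma add_del {V : Type*} (G : SimpleGraph V) {a b : V} (h : G.Adj a b) : addE (delE G a b) a b = G := by
  ext x y
  simp only [addE, delE]
  constructor
  · rintro (h1 | ⟨_, ⟨rfl, rfl⟩ | ⟨rfl, rfl⟩⟩)
    · exact h1.1
    · exact h
    · exact h.symm
  · intro h1
    have := h.ne
    tauto

lemma dg_delE (G : SimpleGraph V) {a b : V} (h : G.Adj a b) (v : V) :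
    dg (delE G a b) v + (if v = a ∨ v = b then 1 else 0) = dg G v := by
  have := dg_addE (delE G a b) h.ne (by simp [delE]) v
  rw [add_del G h] at this
  exact this.symm

lemma exists_nb (G : SimpleGraph V) {r i : V} (h : dg G r < dg G i) :
    ∃ u, G.Adj i u ∧ u ≠ r ∧ ¬ G.Adj r u := by
  by_contra! hc
  apply absurd h
  rw [not_lt]
  unfold dg
  by_cases hri : G.Adj r i
  · have h1 : (univ.filter (fun w => G.Adj i w)).erase r ⊆
        (univ.filter (fun w => G.Adj r w)).erase i := by
      intro w hw
      simp only [mem_erase, mem_filter, mem_univ, true_and] at hw ⊢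
      exact ⟨hw.2.ne', hc w hw.2 hw.1⟩
    have h2 := card_le_card h1
    rw [card_erase_of_mem (by simpa using hri.symm), card_erase_of_mem (by simpa using hri)] at h2
    have : 0 < (univ.filter (fun w => G.Adj r w)).card := card_pos.2 ⟨i, by simpa using hri⟩
    omega
  · apply card_le_card
    intro w hw
    simp only [mem_filter, mem_univ, true_and] at hw ⊢
    apply hc w hw
    rintro rfl
    exact hri hw.symm

/-- `G` is a subrealization of `d`, saturated on `T`, independent outside `U`. -/
structure Good (d : V → ℕ) (T U : Finset V) (G : SimpleGraph V) : Prop where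
  le : ∀ v, dg G v ≤ d v
  sat : ∀ v ∈ T, dg G v = d v
  ind : ∀ x y, x ∉ U → y ∉ U → ¬ G.Adj x y

lemma dg_sum_even (G : SimpleGraph V) : Even (∑ v, dg G v) := by
  have := G.sum_degrees_eq_twice_card_edges
  have h2 : ∑ v, dg G v = ∑ v, G.degree v := by
    apply sum_congr rfl
    intro v _
    unfold dg
    rw [← SimpleGraph.card_neighborFinset_eq_degree]
    congr 1
    ext w; simp
  rw [h2, this]
  exact even_two_mul _

lemma count (G : SimpleGraph V) (U : Finset V)
    (hcl : ∀ x ∈ U, ∀ y ∈ U, x ≠ y → G.Adj x y)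
    (hind : ∀ x y, x ∉ U → y ∉ U → ¬ G.Adj x y) :
    ∑ v ∈ U, dg G v = U.card * (U.card - 1) + ∑ k ∈ Uᶜ, dg G k := by
  have h1 : ∀ v ∈ U, dg G v = (U.card - 1) + ∑ k ∈ Uᶜ, if G.Adj v k then 1 else 0 := by
    intro v hv
    have : univ.filter (fun w => G.Adj v w) = U.erase v ∪ Uᶜ.filter (fun w => G.Adj v w) := by
      ext w
      simp only [mem_filter, mem_univ, true_and, mem_union, mem_erase, mem_compl]
      by_cases hw : w ∈ U
      · simp only [hw, not_true, false_and, or_false, and_true]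
        exact ⟨fun h => h.ne', fun h => hcl v hv w hw h.symm⟩
      · simp [hw]
    unfold dg
    rw [this, card_union_of_disjoint, card_erase_of_mem hv, card_filter]
    rw [disjoint_left]
    intro a ha hb
    simp only [mem_filter, mem_erase, mem_compl] at ha hb
    exact hb.1 ha.2
  have h2 : ∀ k ∈ Uᶜ, dg G k = ∑ v ∈ U, if G.Adj v k then 1 else 0 := by
    intro k hk
    unfold dg
    rw [← card_filter]
    congr 1
    ext w
    simp only [mem_filter, mem_univ, true_and]
    constructor
    · intro h
      refine ⟨?_, h.symm⟩
      by_contra hw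
      exact hind k w (by simpa using hk) hw h
    · exact fun h => h.2.symm
  rw [sum_congr rfl h1, sum_congr rfl h2, sum_add_distrib, sum_const, sum_comm]
  simp

lemma step (d : V → ℕ) (hev : Even (∑ v, d v))
    (heg : ∀ K : Finset V, ∑ v ∈ K, d v ≤ K.card * (K.card - 1) + ∑ v ∈ Kᶜ, min (d v) K.card)
    (T : Finset V) (r : V) (hr : r ∉ T) (hT : ∀ i ∈ T, d r ≤ d i)
    (G : SimpleGraph V) (hG : Good d T (insert r T) G) (hlt : dg G r < d r) :
    ∃ G', Good d T (insert r T) G' ∧ dg G r < dg G' r := by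
  obtain ⟨hle, hsat, hind⟩ := hG
  have hTr : ∀ i ∈ T, i ≠ r := by rintro i hi rfl; exact hr hi
  have hnb : ∀ i ∈ T, ∃ u, G.Adj i u ∧ u ≠ r ∧ ¬ G.Adj r u := fun i hi =>
    exists_nb G (by rw [hsat i hi]; exact hlt.trans_le (hT i hi))
  -- case 0
  by_cases h0 : ∃ k, k ∉ insert r T ∧ dg G k < d k ∧ ¬ G.Adj r k
  · obtain ⟨k, hk, hkd, hrk⟩ := h0
    have hkr : r ≠ k := by rintro rfl; simp at hk
    have D := dg_addE G hkr hrk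
    refine ⟨addE G r k, ⟨?_, ?_, ?_⟩, ?_⟩
    · intro v
      rw [D]
      have := hle v
      split_ifs with h
      · rcases h with rfl | rfl <;> omega
      · omega
    · intro v hv
      suffices hn : ¬ (v = r ∨ v = k) by
        rw [D, if_neg hn, hsat v hv, Nat.add_zero]
      rintro (rfl | rfl)
      · exact hr hv
      · exact hk (mem_insert_of_mem hv)
    · intro x y hx hy h
      rcases h with h | ⟨_, ⟨rfl, rfl⟩ | ⟨rfl, rfl⟩⟩
      · exact hind x y hx hy h
      · simp at hx
      · simp at hy
    · rw [D]; simp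
  push Not at h0
  -- case 1
  by_cases h1 : ∃ i ∈ T, ¬ G.Adj r i
  · obtain ⟨i, hi, hri⟩ := h1
    obtain ⟨u, hiu, hur, hru⟩ := hnb i hi
    have hir := hTr i hi
    have hiu' := hiu.ne
    by_cases h2 : dg G r + 2 ≤ d r
    · have D1 := dg_delE G hiu
      have D2 := dg_addE (delE G i u) hur.symm (by simp only [delE]; tauto)
      have D3 := dg_addE (addE (delE G i u) r u) hir.symm (by
        simp only [addE, delE]
        rintro (h | ⟨_, h | h⟩)
        · exact hri h.1
        · exact hiu' h.2
        · exact hur h.1.symm)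
      refine ⟨addE (addE (delE G i u) r u) r i, ⟨?_, ?_, ?_⟩, ?_⟩
      · intro v
        have e1 := D1 v; have e2 := D2 v; have e3 := D3 v; have := hle v
        grind
      · intro v hv
        have e1 := D1 v; have e2 := D2 v; have e3 := D3 v; have := hsat v hv
        grind
      · intro x y hx hy h
        have := hind x y hx hy
        simp only [addE, delE] at h
        grind
      · have e1 := D1 r; have e2 := D2 r; have e3 := D3 r
        grind
    · have hk : ∃ k, k ∉ insert r T ∧ dg G k < d k := by
        by_contra! hc
        have hs : ∑ v, d v = ∑ v, dg G v + 1 := by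
          rw [← Finset.add_sum_erase univ d (mem_univ r),
            ← Finset.add_sum_erase univ (dg G) (mem_univ r)]
          have : ∑ v ∈ univ.erase r, d v = ∑ v ∈ univ.erase r, dg G v := by
            apply sum_congr rfl
            intro v hv
            by_cases hvT : v ∈ T
            · exact (hsat v hvT).symm
            · exact le_antisymm (hc v (by simp at hv; simp [hv, hvT])) (hle v)
          omega
        have := dg_sum_even G
        rw [hs] at hev
        rw [Nat.even_add_one] at hev
        exact hev this
      obtain ⟨k, hk, hkd⟩ := hk
      have hrk := h0 k hk hkd
      have hkr := hrk.ne
      have D0 := dg_delE G hrk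
      have D1 := dg_delE (delE G r k) (a := i) (b := u) (by simp only [delE]; grind)
      have D2 := dg_addE (delE (delE G r k) i u) hur.symm (by simp only [delE]; tauto)
      have D3 := dg_addE (addE (delE (delE G r k) i u) r u) hir.symm (by
        simp only [addE, delE]
        grind)
      refine ⟨addE (addE (delE (delE G r k) i u) r u) r i, ⟨?_, ?_, ?_⟩, ?_⟩
      · intro v
        have e0 := D0 v; have e1 := D1 v; have e2 := D2 v; have e3 := D3 v; have := hle v
        grind
      · intro v hv
        have e0 := D0 v; have e1 := D1 v; have e2 := D2 v; have e3 := D3 v; have := hsat v hv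
        grind
      · intro x y hx hy h
        have := hind x y hx hy
        simp only [addE, delE] at h
        grind
      · have e0 := D0 r; have e1 := D1 r; have e2 := D2 r; have e3 := D3 r
        grind
  push Not at h1
  -- case 2
  by_cases h2 : ∃ k, k ∉ insert r T ∧ dg G k < min (d k) (T.card + 1)
  · obtain ⟨k, hk, hkd⟩ := h2
    rw [lt_min_iff] at hkd
    have hrk := h0 k hk hkd.1
    have : ∃ i ∈ T, ¬ G.Adj k i := by
      by_contra! hc
      have : insert r T ⊆ univ.filter (fun w => G.Adj k w) := by
        intro w hw
        rw [mem_insert] at hw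
        rcases hw with rfl | hw
        · simpa using hrk.symm
        · simpa using hc w hw
      have := card_le_card this
      rw [card_insert_of_notMem hr] at this
      have h3 := hkd.2
      unfold dg at h3
      omega
    obtain ⟨i, hi, hki⟩ := this
    obtain ⟨u, hiu, hur, hru⟩ := hnb i hi
    have hir := hTr i hi
    have hiu' := hiu.ne
    have hik : i ≠ k := by rintro rfl; exact hk (mem_insert_of_mem hi)
    have hrk' := hrk.ne
    have huT : u ∉ T := fun h => hru (h1 u h)
    have hki' : ¬ G.Adj i k := fun h => hki h.symm
    have D1 := dg_delE G hiu
    have D2 := dg_addE (delE G i u) hur.symm (by simp only [delE]; tauto)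
    have D3 := dg_addE (addE (delE G i u) r u) hik (by
      simp only [addE, delE]
      grind)
    refine ⟨addE (addE (delE G i u) r u) i k, ⟨?_, ?_, ?_⟩, ?_⟩
    · intro v
      have e1 := D1 v; have e2 := D2 v; have e3 := D3 v; have := hle v
      grind
    · intro v hv
      have e1 := D1 v; have e2 := D2 v; have e3 := D3 v; have := hsat v hv
      grind
    · intro x y hx hy h
      have := hind x y hx hy
      simp only [addE, delE] at h
      grind
    · have e1 := D1 r; have e2 := D2 r; have e3 := D3 r
      grind
  push Not at h2
  -- case 3
  by_cases h3 : ∃ i ∈ T, ∃ j ∈ T, i ≠ j ∧ ¬ G.Adj i j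
  · obtain ⟨i, hi, j, hj, hij, hnij⟩ := h3
    obtain ⟨u, hiu, hur, hru⟩ := hnb i hi
    obtain ⟨w, hjw, hwr, hrw⟩ := hnb j hj
    have hir := hTr i hi
    have hjr := hTr j hj
    have huT : u ∉ T := fun h => hru (h1 u h)
    have hwT : w ∉ T := fun h => hrw (h1 w h)
    have D0 := dg_delE G hiu
    have D1 := dg_delE (delE G i u) (a := j) (b := w) (by simp only [delE]; grind)
    have D2 := dg_addE (delE (delE G i u) j w) hij (by simp only [delE]; tauto)
    have D3 := dg_addE (addE (delE (delE G i u) j w) i j) hur.symm (by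
      simp only [addE, delE]
      grind)
    refine ⟨addE (addE (delE (delE G i u) j w) i j) r u, ⟨?_, ?_, ?_⟩, ?_⟩
    · intro v
      have e0 := D0 v; have e1 := D1 v; have e2 := D2 v; have e3 := D3 v; have := hle v
      grind
    · intro v hv
      have e0 := D0 v; have e1 := D1 v; have e2 := D2 v; have e3 := D3 v; have := hsat v hv
      grind
    · intro x y hx hy h
      have := hind x y hx hy
      simp only [addE, delE] at h
      grind
    · have e0 := D0 r; have e1 := D1 r; have e2 := D2 r; have e3 := D3 r
      grind
  push Not at h3
  -- final contradiction
  exfalso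
  have hc := count G (insert r T) (by
    intro x hx y hy hxy
    rw [mem_insert] at hx hy
    rcases hx with rfl | hx <;> rcases hy with rfl | hy
    · exact absurd rfl hxy
    · exact h1 y hy
    · exact (h1 x hx).symm
    · exact h3 x hx y hy hxy) hind
  have hK := heg (insert r T)
  have hs : ∑ v ∈ (insert r T)ᶜ, min (d v) (insert r T).card ≤ ∑ k ∈ (insert r T)ᶜ, dg G k := by
    apply sum_le_sum
    intro k hk
    rw [card_insert_of_notMem hr]
    exact h2 k (by simpa using hk)
  have hl : ∑ v ∈ insert r T, dg G v < ∑ v ∈ insert r T, d v :=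
    sum_lt_sum (fun v _ => hle v) ⟨r, mem_insert_self _ _, hlt⟩
  omega

lemma stage (d : V → ℕ) (hev : Even (∑ v, d v))
    (heg : ∀ K : Finset V, ∑ v ∈ K, d v ≤ K.card * (K.card - 1) + ∑ v ∈ Kᶜ, min (d v) K.card)
    (T : Finset V) (r : V) (hr : r ∉ T) (hT : ∀ i ∈ T, d r ≤ d i) :
    ∀ (t : ℕ) (G : SimpleGraph V), Good d T (insert r T) G → d r - dg G r = t →
      ∃ G', Good d (insert r T) (insert r T) G' := by
  intro t
  induction t using Nat.strong_induction_on with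
  | _ t ih =>
    intro G hG ht
    by_cases hlt : dg G r < d r
    · obtain ⟨G', hG', h⟩ := step d hev heg T r hr hT G hG hlt
      exact ih (d r - dg G' r) (by omega) G' hG' rfl
    · refine ⟨G, hG.le, ?_, hG.ind⟩
      intro v hv
      rw [mem_insert] at hv
      rcases hv with rfl | hv
      · exact le_antisymm (hG.le v) (not_lt.1 hlt)
      · exact hG.sat v hv

lemma stages (d : V → ℕ) (hev : Even (∑ v, d v))
    (heg : ∀ K : Finset V, ∑ v ∈ K, d v ≤ K.card * (K.card - 1) + ∑ v ∈ Kᶜ, min (d v) K.card) :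
    ∀ k ≤ Fintype.card V, ∃ T : Finset V, T.card = k ∧ (∀ i ∈ T, ∀ j, j ∉ T → d j ≤ d i) ∧
      ∃ G, Good d T T G := by
  intro k
  induction k with
  | zero =>
    intro _
    refine ⟨∅, rfl, by simp, ⊥, ?_, by simp, by simp⟩
    intro v
    simp [dg]
  | succ k ih =>
    intro hk
    obtain ⟨T, hTc, hT, G, hG⟩ := ih (by omega)
    have hne : (Tᶜ).Nonempty := by
      rw [← card_pos, card_compl]; omega
    obtain ⟨r, hr, hmax⟩ := exists_max_image Tᶜ d hne
    rw [mem_compl] at hr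
    refine ⟨insert r T, by rw [card_insert_of_notMem hr, hTc], ?_, ?_⟩
    · intro i hi j hj
      rw [mem_insert] at hi hj
      push Not at hj
      rcases hi with rfl | hi
      · exact hmax j (by simpa using hj.2)
      · exact hT i hi j hj.2
    · refine stage d hev heg T r hr (fun i hi => hT i hi r hr) _ G ⟨hG.le, hG.sat, ?_⟩ rfl
      intro x y hx hy
      exact hG.ind x y (fun h => hx (mem_insert_of_mem h)) (fun h => hy (mem_insert_of_mem h))

theorem erdos_gallai (d : V → ℕ) (hev : Even (∑ v, d v))
    (heg : ∀ K : Finset V, ∑ v ∈ K, d v ≤ K.card * (K.card - 1) + ∑ v ∈ Kᶜ, min (d v) K.card) :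
    ∃ G : SimpleGraph V, ∀ v, dg G v = d v := by
  obtain ⟨T, hTc, -, G, hG⟩ := stages d hev heg _ le_rfl
  have : T = univ := (card_eq_iff_eq_univ T).1 hTc
  exact ⟨G, fun v => hG.sat v (by simp [this])⟩

end EG

namespace EG
open Finset Classical

lemma arith1 (m N p q k s : ℤ) (hm : 5 ≤ m) (hN : 2 * m ≤ N) (hq : 0 ≤ q) (hqp : q ≤ p)
    (hqk : q ≤ k) (hs : s ≤ k) :
    q * (N - 1) + (k - q) * m + (k - q) * (m - 1)
      ≤ k * (k - 1) + ((2 * m - s) * k + (N - 2 * m - (k - s)) * q) := by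
  nlinarith [mul_nonneg (sub_nonneg.2 hqk) (sub_nonneg.2 hs)]

lemma arith2 (m N q k s : ℤ) (hm : 5 ≤ m) (hN : 2 * m ≤ N) (hq : 0 ≤ q) (hqp : q ≤ m - 3)
    (hk : m ≤ k) (hs : s ≤ k) (hs2 : s ≤ 2 * m) :
    q * (N - 1) + (k - q) * m
      ≤ k * (k - 1) + ((2 * m - s) * (m - 2) + (N - 2 * m - (k - s)) * q) := by
  rcases le_total k (2 * m) with h | h
  · have h1 : 0 ≤ (m - 2 - q) * (k - s) := mul_nonneg (by omega) (by omega)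
    have h2 : q * (2 * m - 1) + (k - q) * m ≤ k * (k - 1) + (2 * m - k) * (m - 2) := by
      have h3 : 0 ≤ (m - 3 - q) * (m - 1) := mul_nonneg (by omega) (by omega)
      have h4 : 0 ≤ (k - m) * (k - m) := mul_nonneg (by omega) (by omega)
      nlinarith
    nlinarith
  · have h1 : 0 ≤ (m - 2 - q) * (2 * m - s) := mul_nonneg (by omega) (by omega)
    have h2 : 0 ≤ (k - q) * (k - 1 - m) := mul_nonneg (by omega) (by omega)
    nlinarith

lemma verify {V : Type*} [Fintype V] (m p : ℕ) (hm : 5 ≤ m) (hp : p ≤ m - 3) (e : V → ℕ)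
    (P W : Finset V) (hW : W.card = 2 * m) (hP : P.card = p)
    (h1 : ∀ v ∈ P, e v ≤ Fintype.card V - 1) (h2 : ∀ v, v ∉ P → e v ≤ m)
    (h3 : ∀ v ∈ W, m - 2 ≤ e v) (h4 : ∀ v, p ≤ e v)
    (h5 : (univ.filter (fun v => v ∈ W ∧ e v < m - 1)).card ≤ m - 1)
    (K : Finset V) :
    ∑ v ∈ K, e v ≤ K.card * (K.card - 1) + ∑ v ∈ Kᶜ, min (e v) K.card := by
  set N := Fintype.card V with hN
  have hNW : 2 * m ≤ N := hW ▸ card_le_univ W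
  set k := K.card with hk
  set q := (K ∩ P).card with hq
  set s := (K ∩ W).card with hs
  have hqp : q ≤ p := hP ▸ card_le_card inter_subset_right
  have hqk : q ≤ k := card_le_card inter_subset_left
  have hsk : s ≤ k := card_le_card inter_subset_left
  have hsW : s ≤ 2 * m := hW ▸ card_le_card inter_subset_right
  have hkN : k ≤ N := card_le_univ K
  -- left side
  have hL : ∑ v ∈ K, e v ≤ q * (N - 1) + (k - q) * m := by
    rw [← sum_inter_add_sum_sdiff K P]
    apply Nat.add_le_add
    · rw [hq, ← smul_eq_mul]
      apply sum_le_card_nsmul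
      intro v hv
      exact h1 v (mem_inter.1 hv).2
    · have : (K \ P).card = k - q := by
        have := card_sdiff_add_card_inter K P
        omega
      rw [← this, ← smul_eq_mul]
      apply sum_le_card_nsmul
      intro v hv
      exact h2 v (mem_sdiff.1 hv).2
  have hc1 : (Kᶜ ∩ W).card = 2 * m - s := by
    have : Kᶜ ∩ W = W \ K := by ext; simp [and_comm]
    rw [this]
    have := card_sdiff_add_card_inter W K
    rw [inter_comm] at this
    omega
  have hc2 : (Kᶜ \ W).card = N - k - (2 * m - s) := by
    have := card_sdiff_add_card_inter Kᶜ W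
    have h : (Kᶜ).card = N - k := card_compl K
    omega
  have hc3 : 2 * m - s ≤ N - k := by
    have := card_le_card (inter_subset_left : Kᶜ ∩ W ⊆ Kᶜ)
    have h : (Kᶜ).card = N - k := card_compl K
    omega
  have hR2 : (N - k - (2 * m - s)) * q ≤ ∑ v ∈ Kᶜ \ W, min (e v) k := by
    rw [← hc2, ← smul_eq_mul]
    apply card_nsmul_le_sum
    intro v _
    exact le_min (hqp.trans (h4 v)) hqk
  rw [← sum_inter_add_sum_sdiff Kᶜ W]
  rcases Nat.lt_or_ge k m with hkm | hkm
  · have hR1 : (2 * m - s) * k ≤ ∑ v ∈ Kᶜ ∩ W, min (e v) k + (k - q) * (m - 1) := by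
      rcases Nat.lt_or_ge k (m - 1) with hk1 | hk1
      · refine le_trans ?_ (Nat.le_add_right _ _)
        rw [← hc1, ← smul_eq_mul]
        apply card_nsmul_le_sum
        intro v hv
        exact le_min ((by omega : k ≤ m - 2).trans (h3 v (mem_inter.1 hv).2)) le_rfl
      · have hkk : k = m - 1 := by omega
        have a1 : (2 * m - s) * k ≤ ∑ v ∈ Kᶜ ∩ W,
            (min (e v) k + if v ∈ W ∧ e v < m - 1 then 1 else 0) := by
          rw [← hc1, ← smul_eq_mul]
          apply card_nsmul_le_sum
          intro v hv
          have hvW := (mem_inter.1 hv).2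
          have := h3 v hvW
          simp only [hvW, true_and]
          split_ifs <;> omega
        rw [sum_add_distrib, ← card_filter] at a1
        have a2 : ((Kᶜ ∩ W).filter (fun v => v ∈ W ∧ e v < m - 1)).card ≤ m - 1 :=
          (card_le_card (filter_subset_filter _ (subset_univ _))).trans h5
        have a3 : 1 * (m - 1) ≤ (k - q) * (m - 1) := Nat.mul_le_mul_right _ (by omega)
        omega
    have := arith1 m N p q k s (by omega) (by omega) (by omega) (by omega) (by omega) (by omega)
    zify [hqk, (by omega : 1 ≤ m), (by omega : 1 ≤ N), (by omega : s ≤ 2 * m), hkN, hc3] at hL hR1 hR2 ⊢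
    rcases Nat.eq_zero_or_pos k with h0 | h0
    · have : K = ∅ := card_eq_zero.1 h0
      have : ∑ v ∈ K, e v = 0 := by rw [this]; simp
      have : ∑ v ∈ K, (e v : ℤ) = 0 := by exact_mod_cast this
      rw [this]; positivity
    · push_cast [Nat.cast_sub h0]
      nlinarith
  · have hR1 : (2 * m - s) * (m - 2) ≤ ∑ v ∈ Kᶜ ∩ W, min (e v) k := by
      rw [← hc1, ← smul_eq_mul]
      apply card_nsmul_le_sum
      intro v hv
      exact le_min (h3 v (mem_inter.1 hv).2) (by omega)
    have := arith2 m N q k s (by omega) (by omega) (by omega) (by omega) (by omega) (by omega) (by omega)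
    zify [hqk, (by omega : 1 ≤ m), (by omega : 2 ≤ m), (by omega : 1 ≤ N), (by omega : 1 ≤ k), (by omega : s ≤ 2 * m), hkN, hc3] at hL hR1 hR2 ⊢
    nlinarith

lemma dg_eq_ncard {n : ℕ} (G : SimpleGraph (Fin n)) (v : Fin n) :
    (G.neighborSet v).ncard = dg G v := by
  unfold dg
  rw [← Set.ncard_coe_finset]
  congr 1
  ext w; simp

lemma dg_le {V : Type*} [Fintype V] (G : SimpleGraph V) (v : V) :
    dg G v ≤ Fintype.card V - 1 := by
  unfold dg
  have : univ.filter (fun w => G.Adj v w) ⊆ univ.erase v := by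
    intro w hw
    simp only [mem_filter, mem_univ, true_and] at hw
    simpa using hw.ne'
  have := card_le_card this
  rwa [card_erase_of_mem (mem_univ v), card_univ] at this

lemma general (m n : ℕ) (hm : 5 ≤ m) (hn : 2 * m + 1 ≤ n) (d : Fin n → ℕ)
    (hgr : Graphic d) (p : ℕ) (hp : p ≤ m - 3)
    (hbig : ∀ i : Fin n, (i : ℕ) ≤ 2 * m → m - 1 ≤ d i)
    (hlow : ∀ i : Fin n, p + 1 ≤ d i)
    (hsm : ∀ i : Fin n, p ≤ (i : ℕ) → d i ≤ m)
    (hv : ∀ i : Fin n, (i : ℕ) = 2 * m → d i = m - 1)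
    (dec : ℕ → Prop) [DecidablePred dec] (hdp : ∀ i < p, dec i) (hd2 : ¬ dec (2 * m))
    (hcard : ((range n).filter dec).card = m - 1) :
    Graphic (fun j : Fin (n - 1) =>
        let i : Fin n := if (j : ℕ) < 2 * m then ⟨(j : ℕ), by omega⟩ else ⟨(j : ℕ) + 1, by omega⟩
        if dec (i : ℕ) then d i - 1 else d i) := by
  obtain ⟨N, rfl⟩ : ∃ N, n = N + 1 := ⟨n - 1, by omega⟩
  obtain ⟨G, hG⟩ := hgr
  have hG' : ∀ v, dg G v = d v := fun v => (dg_eq_ncard G v).symm.trans (hG v)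
  have hdle : ∀ v, d v ≤ N := fun v => by
    have := dg_le G v
    rw [hG'] at this
    simpa using this
  set c : Fin (N + 1) := ⟨2 * m, by omega⟩ with hc
  change Graphic (n := N) _
  set e : Fin N → ℕ := fun j => if dec (c.succAbove j : ℕ) then d (c.succAbove j) - 1
    else d (c.succAbove j) with he
  have hval : ∀ j : Fin N, (c.succAbove j : ℕ) = if (j : ℕ) < 2 * m then (j : ℕ) else j + 1 := by
    intro j
    rw [Fin.succAbove]
    simp only [Fin.lt_def, hc, Fin.val_castSucc]
    split_ifs <;> simp
  have hee : (fun j : Fin N =>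
        let i : Fin (N + 1) := if (j : ℕ) < 2 * m then ⟨(j : ℕ), by omega⟩ else ⟨(j : ℕ) + 1, by omega⟩
        if dec (i : ℕ) then d i - 1 else d i) = e := by
    funext j
    have : (if (j : ℕ) < 2 * m then (⟨(j : ℕ), by omega⟩ : Fin (N + 1))
        else ⟨(j : ℕ) + 1, by omega⟩) = c.succAbove j := by
      ext
      rw [hval]
      split_ifs <;> rfl
    simp only [this, he]
  have goal : Graphic e := by
    have hdc : ∑ j : Fin N, (if dec (c.succAbove j : ℕ) then 1 else 0) = m - 1 := by
      rw [card_filter, ← Fin.sum_univ_eq_sum_range (fun i => if dec i then 1 else 0),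
        Fin.sum_univ_succAbove _ c] at hcard
      simpa [hc, hd2] using hcard
    have hsum : ∑ i, d i = (m - 1) + (∑ j, e j + (m - 1)) := by
      have hs : ∑ j, d (c.succAbove j) = ∑ j, e j + (m - 1) := by
        rw [← hdc, ← sum_add_distrib]
        apply sum_congr rfl
        intro j _
        have := hlow (c.succAbove j)
        simp only [he]
        split_ifs <;> omega
      rw [Fin.sum_univ_succAbove _ c, hv c rfl, hs]
    have hev : Even (∑ j, e j) := by
      have h := dg_sum_even G
      simp only [hG'] at h
      rw [hsum] at h
      rw [Nat.even_iff] at h ⊢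
      omega
    have hfc : ∀ t, t ≤ N → (univ.filter (fun j : Fin N => (j : ℕ) < t)).card = t := by
      intro t ht
      rw [card_filter, Fin.sum_univ_eq_sum_range (fun i => if i < t then 1 else 0), ← card_filter]
      have : (range N).filter (fun i => i < t) = range t := by
        ext i; simp; omega
      rw [this, card_range]
    obtain ⟨H, hH⟩ := erdos_gallai e hev (fun K => by
      refine verify m p hm hp e (univ.filter (fun j : Fin N => (j : ℕ) < p))
        (univ.filter (fun j : Fin N => (j : ℕ) < 2 * m)) (hfc _ (by omega)) (hfc _ (by omega))
        ?_ ?_ ?_ ?_ ?_ K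
      · intro j hj
        simp only [mem_filter, mem_univ, true_and] at hj
        have h1 := hval j
        rw [if_pos (by omega)] at h1
        have h2 := hdp _ hj
        have := hdle (c.succAbove j)
        simp only [he, h1, h2, if_true, Fintype.card_fin]
        omega
      · intro j hj
        simp only [mem_filter, mem_univ, true_and, not_lt] at hj
        have h1 := hval j
        have := hsm (c.succAbove j) (by rw [h1]; split_ifs <;> omega)
        simp only [he]
        split_ifs <;> omega
      · intro j hj
        simp only [mem_filter, mem_univ, true_and] at hj
        have h1 := hval j
        rw [if_pos hj] at h1
        have := hbig (c.succAbove j) (by omega)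
        simp only [he]
        split_ifs <;> omega
      · intro j
        have := hlow (c.succAbove j)
        simp only [he]
        split_ifs <;> omega
      · refine le_trans ?_ (le_of_eq ((card_filter _ _).trans hdc))
        apply card_le_card
        intro j hj
        simp only [mem_filter, mem_univ, true_and] at hj ⊢
        have h1 := hval j
        rw [if_pos hj.1] at h1
        have := hbig (c.succAbove j) (by omega)
        by_contra hcon
        have h2 := hj.2
        simp only [he, hcon, if_false] at h2
        omega)
    exact ⟨H, fun j => (dg_eq_ncard H j).trans (hH j)⟩
  rw [← hee] at goal
  exact goal

end EG

/-- **Lemma 2.4.** Let `m ≥ 5`, `n ≥ 2m+1` and `π = (d₁,…,dₙ)` be a non-increasing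
graphic sequence with `m-1 ≥ dₙ ≥ 1`, `d_{dₙ-1} = ⋯ = d_{m+2} = m` and
`d_{m+3} = ⋯ = d_{2m+1} = m-1`. Let `p = max{i : dᵢ ≥ m+1}` (`p = 0` if none). Then in
each of the four cases the sequence `ρ`, obtained from `π` by deleting `d_{2m+1}` and
decreasing the indicated terms by one, is graphic. Below `ρ` is indexed by
`Fin (n-1)`; position `j` corresponds to the original (0-based) position `j` if
`j < 2m` and `j+1` otherwise, and a term is decreased exactly when the predicate on its
original (0-based) position holds. -/
theorem lemma24 (m n : ℕ) (hm : 5 ≤ m) (hn : 2 * m + 1 ≤ n) (d : Fin n → ℕ)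
    (hanti : Antitone d) (hgr : Graphic d)
    (dn : ℕ) (hdn_def : dn = d ⟨n - 1, by omega⟩)
    (hdn_ub : dn ≤ m - 1) (hdn_lb : 1 ≤ dn)
    (hmid : ∀ i : ℕ, ∀ _ : dn - 1 ≤ i, ∀ _ : 1 ≤ i, ∀ _ : i ≤ m + 2, d ⟨i - 1, by omega⟩ = m)
    (htail : ∀ i : ℕ, ∀ _ : m + 3 ≤ i, ∀ _ : i ≤ 2 * m + 1, d ⟨i - 1, by omega⟩ = m - 1)
    (p : ℕ) (hpn : p ≤ n)
    (hp1 : ∀ i : ℕ, ∀ _ : 1 ≤ i, ∀ _ : i ≤ p, m + 1 ≤ d ⟨i - 1, by omega⟩)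
    (hp2 : ∀ i : ℕ, ∀ _ : p < i, ∀ _ : i ≤ n, d ⟨i - 1, by omega⟩ ≤ m) :
    (p = 0 → 2 * m + 3 ≤ n →
      Graphic (fun j : Fin (n - 1) =>
        let i : Fin n := if (j : ℕ) < 2 * m then ⟨(j : ℕ), by omega⟩ else ⟨(j : ℕ) + 1, by omega⟩
        if (m + 3 ≤ (i : ℕ) ∧ (i : ℕ) ≤ 2 * m - 1) ∨ (i : ℕ) = 2 * m + 1 ∨ (i : ℕ) = 2 * m + 2
        then d i - 1 else d i)) ∧
    (p = 1 → 2 * m + 2 ≤ n →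
      Graphic (fun j : Fin (n - 1) =>
        let i : Fin n := if (j : ℕ) < 2 * m then ⟨(j : ℕ), by omega⟩ else ⟨(j : ℕ) + 1, by omega⟩
        if (i : ℕ) = 0 ∨ (m + 3 ≤ (i : ℕ) ∧ (i : ℕ) ≤ 2 * m - 1) ∨ (i : ℕ) = 2 * m + 1
        then d i - 1 else d i)) ∧
    (p = 2 →
      Graphic (fun j : Fin (n - 1) =>
        let i : Fin n := if (j : ℕ) < 2 * m then ⟨(j : ℕ), by omega⟩ else ⟨(j : ℕ) + 1, by omega⟩
        if (i : ℕ) ≤ 1 ∨ (m + 3 ≤ (i : ℕ) ∧ (i : ℕ) ≤ 2 * m - 1)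
        then d i - 1 else d i)) ∧
    (3 ≤ p →
      Graphic (fun j : Fin (n - 1) =>
        let i : Fin n := if (j : ℕ) < 2 * m then ⟨(j : ℕ), by omega⟩ else ⟨(j : ℕ) + 1, by omega⟩
        if (i : ℕ) ≤ p - 1 ∨ (m + 3 ≤ (i : ℕ) ∧ (i : ℕ) ≤ 2 * m + 1 - p)
        then d i - 1 else d i)) := by
  have hdn : ∀ i : Fin n, dn ≤ d i := by
    intro i
    rw [hdn_def]
    apply hanti
    rw [Fin.le_def]
    simp only
    omega
  have hp0 : p + 1 ≤ dn ∧ p ≤ m - 3 := by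
    by_cases h : dn ≤ 2
    · have h1 := hmid 1 (by omega) le_rfl (by omega)
      have : p = 0 := by
        by_contra hne
        have h2 := hp1 1 le_rfl (by omega)
        omega
      omega
    · have h1 := hmid (dn - 1) le_rfl (by omega) (by omega)
      have : ¬ (dn - 1 ≤ p) := by
        intro hle
        have h2 := hp1 (dn - 1) (by omega) hle
        omega
      omega
  have hv : ∀ i : Fin n, (i : ℕ) = 2 * m → d i = m - 1 := by
    intro i hi
    have := htail (2 * m + 1) (by omega) le_rfl
    rw [← this]
    congr 1
    ext
    simp [hi]
  have hbig : ∀ i : Fin n, (i : ℕ) ≤ 2 * m → m - 1 ≤ d i := by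
    intro i hi
    rw [← hv ⟨2 * m, by omega⟩ rfl]
    apply hanti
    rw [Fin.le_def]
    exact hi
  have hsm : ∀ i : Fin n, p ≤ (i : ℕ) → d i ≤ m := by
    intro i hi
    exact hp2 (i + 1) (by omega) (by omega)
  have key := EG.general m n hm hn d hgr p hp0.2 hbig (fun i => hp0.1.trans (hdn i)) hsm hv
  refine ⟨?_, ?_, ?_, ?_⟩
  · intro hp hn3
    refine key (fun i => (m + 3 ≤ i ∧ i ≤ 2 * m - 1) ∨ i = 2 * m + 1 ∨ i = 2 * m + 2)
      (by intro i hi; omega) (by omega) ?_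
    have : (Finset.range n).filter
        (fun i => (m + 3 ≤ i ∧ i ≤ 2 * m - 1) ∨ i = 2 * m + 1 ∨ i = 2 * m + 2) =
        Finset.Icc (m + 3) (2 * m - 1) ∪ Finset.Icc (2 * m + 1) (2 * m + 2) := by
      ext i; simp only [Finset.mem_filter, Finset.mem_range, Finset.mem_union, Finset.mem_Icc]; omega
    rw [this, Finset.card_union_of_disjoint, Nat.card_Icc, Nat.card_Icc]
    · omega
    · rw [Finset.disjoint_left]; intro i; simp only [Finset.mem_Icc]; omega
  · intro hp hn3
    refine key (fun i => i = 0 ∨ (m + 3 ≤ i ∧ i ≤ 2 * m - 1) ∨ i = 2 * m + 1)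
      (by intro i hi; omega) (by omega) ?_
    have : (Finset.range n).filter
        (fun i => i = 0 ∨ (m + 3 ≤ i ∧ i ≤ 2 * m - 1) ∨ i = 2 * m + 1) =
        insert 0 (insert (2 * m + 1) (Finset.Icc (m + 3) (2 * m - 1))) := by
      ext i; simp only [Finset.mem_filter, Finset.mem_range, Finset.mem_insert, Finset.mem_Icc]; omega
    rw [this, Finset.card_insert_of_notMem, Finset.card_insert_of_notMem, Nat.card_Icc]
    · omega
    · simp only [Finset.mem_Icc]; omega
    · simp only [Finset.mem_insert, Finset.mem_Icc]; omega
  · intro hp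
    refine key (fun i => i ≤ 1 ∨ (m + 3 ≤ i ∧ i ≤ 2 * m - 1))
      (by intro i hi; omega) (by omega) ?_
    have : (Finset.range n).filter
        (fun i => i ≤ 1 ∨ (m + 3 ≤ i ∧ i ≤ 2 * m - 1)) =
        Finset.range 2 ∪ Finset.Icc (m + 3) (2 * m - 1) := by
      ext i; simp only [Finset.mem_filter, Finset.mem_range, Finset.mem_union, Finset.mem_Icc]; omega
    rw [this, Finset.card_union_of_disjoint, Nat.card_Icc, Finset.card_range]
    · omega
    · rw [Finset.disjoint_left]; intro i; simp only [Finset.mem_Icc, Finset.mem_range]; omega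
  · intro hp
    refine key (fun i => i ≤ p - 1 ∨ (m + 3 ≤ i ∧ i ≤ 2 * m + 1 - p))
      (by intro i hi; omega) (by omega) ?_
    have : (Finset.range n).filter
        (fun i => i ≤ p - 1 ∨ (m + 3 ≤ i ∧ i ≤ 2 * m + 1 - p)) =
        Finset.range p ∪ Finset.Icc (m + 3) (2 * m + 1 - p) := by
      ext i; simp only [Finset.mem_filter, Finset.mem_range, Finset.mem_union, Finset.mem_Icc]; omega
    rw [this, Finset.card_union_of_disjoint, Nat.card_Icc, Finset.card_range]
    · omega
    · rw [Finset.disjoint_left]; intro i; simp only [Finset.mem_Icc, Finset.mem_range]; omega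
end

section
/- Let m ≥ 5, n ≥ 2m+1, and let π = (d_1, …, d_n) be a non-increasing graphic sequence with m−1 ≥ d_{2m} ≥ d_{2m+1} ≥ 1, d_{d_n−1} = d_{d_n} = ⋯ = d_{m+1} = m, and d_{2m+1−i} ≥ i+1 for 1 ≤ i ≤ m−1. Let p = max{i : d_i ≥ m+1} (so d_{2m} ≥ p+2). If p ≥ 1 or d_{2m} ≤ m−2, let ω₂ = (d_1−2, …, d_p−2, d_{p+1}−1, …, d_{m+1}−1, d_{m+3}−1, …, d_r−1, d_{r+1}, …, d_{2m−1}, d_{2m+1}, …, d_n), where r = m+1+d_{2m}−p. If p = 0 and d_{2m} = m−1, let ω₂ = (d_1−1, …, d_{m+1}−1, d_{m+3}−1, …, d_{2m−1}−1, d_{2m+1}−1, d_{2m+2}, …, d_n). Then ω₂ is graphic. -/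
/-- `f` restricted to `s` is realized by a graph whose edges lie inside `s`. -/
def RealOn {V : Type*} (s : Finset V) (f : V → ℕ) : Prop :=
  ∃ G : SimpleGraph V, (∀ a b, G.Adj a b → a ∈ s ∧ b ∈ s) ∧
    ∀ v ∈ s, (G.neighborSet v).ncard = f v

/-- Adding a vertex `v` joined to the set `A`. -/
lemma RealOn.add_vertex {V : Type*} [Fintype V] [DecidableEq V] {s : Finset V} {f : V → ℕ}
    {v : V} (hv : v ∈ s) {A : Finset V} (hA : A ⊆ s.erase v) (hc : A.card = f v)
    (hpos : ∀ a ∈ A, 1 ≤ f a)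
    (h : RealOn (s.erase v) (fun w => f w - if w ∈ A then 1 else 0)) : RealOn s f := by
  obtain ⟨G, hG, hd⟩ := h
  have hvA : v ∉ A := fun h => by simpa using hA h
  have hAs : ∀ a ∈ A, a ∈ s := fun a ha => Finset.mem_of_mem_erase (hA ha)
  have hGv : ∀ a, ¬ G.Adj v a := fun a ha => by simpa using (hG _ _ ha).1
  have hGv' : ∀ a, ¬ G.Adj a v := fun a ha => by simpa using (hG _ _ ha).2
  let H : SimpleGraph V :=
    { Adj := fun a b => G.Adj a b ∨ (a = v ∧ b ∈ A) ∨ (b = v ∧ a ∈ A)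
      symm := ⟨by
        intro a b hab
        rcases hab with h | h | h
        · exact Or.inl h.symm
        · exact Or.inr (Or.inr h)
        · exact Or.inr (Or.inl h)⟩
      loopless := ⟨by
        intro a ha
        rcases ha with h | ⟨h, h'⟩ | ⟨h, h'⟩
        · exact G.loopless.irrefl a h
        · exact hvA (h ▸ h')
        · exact hvA (h ▸ h')⟩ }
  refine ⟨H, ?_, ?_⟩
  · rintro a b (h | ⟨rfl, h⟩ | ⟨rfl, h⟩)
    · exact ⟨Finset.mem_of_mem_erase (hG _ _ h).1, Finset.mem_of_mem_erase (hG _ _ h).2⟩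
    · exact ⟨hv, hAs _ h⟩
    · exact ⟨hAs _ h, hv⟩
  · intro w hw
    by_cases hwv : w = v
    · subst hwv
      have : H.neighborSet w = (A : Set V) := by
        ext b
        simp only [SimpleGraph.mem_neighborSet, H, Finset.mem_coe]
        constructor
        · rintro (h | h | h)
          · exact absurd h (hGv b)
          · exact h.2
          · exact absurd h.2 hvA
        · intro h; exact Or.inr (Or.inl ⟨trivial, h⟩)
      rw [this, Set.ncard_coe_finset, hc]
    · have hdw := hd w (by simp [hwv, hw])
      by_cases hwA : w ∈ A
      · have : H.neighborSet w = insert v (G.neighborSet w) := by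
          ext b
          simp only [SimpleGraph.mem_neighborSet, H, Set.mem_insert_iff]
          constructor
          · rintro (h | h | h)
            · exact Or.inr h
            · exact absurd h.1 hwv
            · exact Or.inl h.1
          · rintro (h | h)
            · exact Or.inr (Or.inr ⟨h, hwA⟩)
            · exact Or.inl h
        rw [this, Set.ncard_insert_of_notMem (by simpa using hGv' w) (Set.toFinite _), hdw]
        have := hpos w hwA
        simp only [hwA, if_true]
        omega
      · have : H.neighborSet w = G.neighborSet w := by
          ext b
          simp only [SimpleGraph.mem_neighborSet, H]
          constructor
          · rintro (h | h | h)
            · exact h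
            · exact absurd h.1 hwv
            · exact absurd h.2 hwA
          · intro h; exact Or.inl h
        rw [this, hdw]
        simp [hwA]

/-- Selecting the `c` largest elements. -/
lemma exists_top {V : Type*} [DecidableEq V] (f : V → ℕ) (t : Finset V) (c : ℕ)
    (hc : c ≤ t.card) :
    ∃ A ⊆ t, A.card = c ∧ ∀ a ∈ A, ∀ b ∈ t, b ∉ A → f b ≤ f a := by
  induction c with
  | zero => exact ⟨∅, by simp, by simp, by simp⟩
  | succ c ih =>
    obtain ⟨A, hA, hAc, hAt⟩ := ih (by omega)
    have hne : (t \ A).Nonempty := by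
      rw [← Finset.card_pos, Finset.card_sdiff_of_subset hA]; omega
    obtain ⟨x, hx, hmax⟩ := Finset.exists_max_image (t \ A) f hne
    rw [Finset.mem_sdiff] at hx
    refine ⟨insert x A, ?_, ?_, ?_⟩
    · exact Finset.insert_subset hx.1 hA
    · rw [Finset.card_insert_of_notMem hx.2, hAc]
    · intro a ha b hb hbA
      rw [Finset.mem_insert, not_or] at hbA
      rcases Finset.mem_insert.1 ha with rfl | ha
      · exact hmax b (by simp [hb, hbA.2])
      · exact hAt a ha b hb hbA.2

lemma even_step {V : Type*} [DecidableEq V] {s : Finset V} {f : V → ℕ}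
    {v : V} (hv : v ∈ s) {A : Finset V} (hA : A ⊆ s.erase v) (hc : A.card = f v)
    (hpos : ∀ a ∈ A, 1 ≤ f a) (he : Even (∑ w ∈ s, f w)) :
    Even (∑ w ∈ s.erase v, (f w - if w ∈ A then 1 else 0)) := by
  have h1 : ∑ w ∈ s.erase v, (f w - if w ∈ A then 1 else 0)
      + ∑ w ∈ s.erase v, (if w ∈ A then 1 else 0) = ∑ w ∈ s.erase v, f w := by
    rw [← Finset.sum_add_distrib]
    refine Finset.sum_congr rfl fun w _ => ?_
    by_cases h : w ∈ A
    · have := hpos w h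
      simp only [h, if_true]; omega
    · simp [h]
  have h2 : ∑ w ∈ s.erase v, (if w ∈ A then 1 else 0) = A.card := by
    rw [← Finset.sum_filter, Finset.sum_const, smul_eq_mul, mul_one,
      Finset.filter_mem_eq_inter, Finset.inter_eq_right.2 hA]
  have h3 := Finset.add_sum_erase s f hv
  rw [← h3] at he
  rw [h2] at h1
  rw [← h1, hc] at he
  grind

/-- The sufficient condition. -/
lemma realOn_of_class {V : Type*} [Fintype V] [DecidableEq V] :
    ∀ (N : ℕ) (s : Finset V) (f : V → ℕ) (m : ℕ), s.card = N →
      Even (∑ w ∈ s, f w) →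
      m + 1 ≤ (s.filter (fun w => m ≤ f w + 1)).card →
      (s.filter (fun w => m < f w)).card ≤ m →
      (∀ w ∈ s, (s.filter (fun w => m < f w)).card ≤ f w) →
      (∀ w ∈ s, f w + 1 ≤ s.card) → RealOn s f := by
  intro N
  induction N with
  | zero =>
    intro s f m hs _ hH
    have := Finset.card_filter_le s (fun w => m ≤ f w + 1)
    omega
  | succ N ih =>
    intro s f m hs he hH hpm hlow hup
    have hHs := Finset.card_filter_le s (fun w => m ≤ f w + 1)
    by_cases hp : (s.filter (fun w => m < f w)).card = 0
    · have hle : ∀ w ∈ s, f w ≤ m := by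
        intro w hw
        by_contra hcon
        rw [Finset.card_eq_zero] at hp
        have : w ∈ s.filter (fun w => m < f w) := by simp [hw]; omega
        simp [hp] at this
      by_cases hm0 : m = 0
      · refine ⟨⊥, by simp, fun v hv => ?_⟩
        have := hle v hv
        simp; omega
      by_cases hcard : s.card = m + 1
      · -- all values are `m - 1` or `m`; remove a vertex of maximum value
        have hge : ∀ w ∈ s, m ≤ f w + 1 := by
          have : s.filter (fun w => m ≤ f w + 1) = s :=
            Finset.eq_of_subset_of_card_le (Finset.filter_subset _ _) (by omega)
          intro w hw
          rw [← this] at hw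
          exact (Finset.mem_filter.1 hw).2
        obtain ⟨v, hv, hmax⟩ := Finset.exists_max_image s f (Finset.card_pos.1 (by omega))
        have htc := Finset.card_erase_of_mem hv
        have hfv := hle v hv
        have hfv' := hge v hv
        obtain ⟨A, hA, hAc, hAt⟩ := exists_top f (s.erase v) (f v) (by omega)
        have hAs : ∀ a ∈ A, a ∈ s := fun a ha => Finset.mem_of_mem_erase (hA ha)
        have hpos : ∀ a ∈ A, 1 ≤ f a := by
          intro a ha
          have h1 := hge a (hAs a ha)
          by_contra hcon
          have hm1 : m = 1 := by omega
          have hAcard := Finset.card_pos.2 ⟨a, ha⟩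
          have hsum := Finset.add_sum_erase s f hv
          have : s.erase v = {a} := by
            symm
            apply Finset.eq_of_subset_of_card_le
            · simpa using hA ha
            · simp; omega
          rw [this, Finset.sum_singleton] at hsum
          rw [← hsum] at he
          have h2 : f v + f a = 1 := by omega
          rw [h2] at he
          simp at he
        have hle' : ∀ w ∈ s.erase v, (f w - if w ∈ A then 1 else 0) ≤ m - 1 := by
          intro w hw
          have hws := Finset.mem_of_mem_erase hw
          by_cases hwA : w ∈ A
          · have := hle w hws
            simp only [hwA, if_true]; omega
          · have h1 := hmax w hws
            have : f v ≠ m := by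
              intro h
              have : A = s.erase v := Finset.eq_of_subset_of_card_le hA (by omega)
              rw [this] at hwA; exact hwA hw
            simp only [hwA, if_false]; omega
        have hp' : ((s.erase v).filter
            (fun w => m - 1 < (f w - if w ∈ A then 1 else 0))).card = 0 := by
          rw [Finset.card_eq_zero, Finset.filter_eq_empty_iff]
          intro w hw
          have := hle' w hw
          omega
        refine RealOn.add_vertex hv hA hAc hpos
          (ih (s.erase v) _ (m - 1) (by omega) (even_step hv hA hAc hpos he) ?_ ?_ ?_ ?_)
        · have : (s.erase v).filter
              (fun w => m - 1 ≤ (f w - if w ∈ A then 1 else 0) + 1) = s.erase v := by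
            rw [Finset.filter_eq_self]
            intro w hw
            have := hge w (Finset.mem_of_mem_erase hw)
            split_ifs <;> omega
          rw [this]; omega
        · rw [hp']; omega
        · intro w hw; rw [hp']; omega
        · intro w hw
          have := hle' w hw
          omega
      · -- remove a vertex of minimum value
        obtain ⟨v, hv, hmin⟩ := Finset.exists_min_image s f (Finset.card_pos.1 (by omega))
        have htc := Finset.card_erase_of_mem hv
        have hfv := hle v hv
        obtain ⟨A, hA, hAc, hAt⟩ := exists_top f (s.erase v) (f v) (by omega)
        have hAs : ∀ a ∈ A, a ∈ s := fun a ha => Finset.mem_of_mem_erase (hA ha)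
        have hpos : ∀ a ∈ A, 1 ≤ f a := by
          intro a ha
          have := hmin a (hAs a ha)
          have := Finset.card_pos.2 ⟨a, ha⟩
          omega
        have hH' : m + 1 ≤ ((s.erase v).filter (fun w => m ≤ f w + 1)).card := by
          by_cases hvH : m ≤ f v + 1
          · have : (s.erase v).filter (fun w => m ≤ f w + 1) = s.erase v := by
              rw [Finset.filter_eq_self]
              intro w hw
              have := hmin w (Finset.mem_of_mem_erase hw)
              omega
            rw [this]; omega
          · refine hH.trans (Finset.card_le_card ?_)
            intro w hw
            rw [Finset.mem_filter] at hw ⊢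
            refine ⟨Finset.mem_erase.2 ⟨?_, hw.1⟩, hw.2⟩
            rintro rfl
            exact hvH hw.2
        by_cases hall : ∀ a ∈ A, m ≤ f a
        · have hp' : ((s.erase v).filter
              (fun w => m < (f w - if w ∈ A then 1 else 0))).card = 0 := by
            rw [Finset.card_eq_zero, Finset.filter_eq_empty_iff]
            intro w hw
            have := hle w (Finset.mem_of_mem_erase hw)
            omega
          refine RealOn.add_vertex hv hA hAc hpos
            (ih (s.erase v) _ m (by omega) (even_step hv hA hAc hpos he) ?_ ?_ ?_ ?_)
          · refine hH'.trans (Finset.card_le_card ?_)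
            intro w hw
            rw [Finset.mem_filter] at hw ⊢
            refine ⟨hw.1, ?_⟩
            by_cases hwA : w ∈ A
            · have := hall w hwA
              simp only [hwA, if_true]; omega
            · simp only [hwA, if_false]; omega
          · rw [hp']; omega
          · intro w hw; rw [hp']; omega
          · intro w hw
            have := hle w (Finset.mem_of_mem_erase hw)
            omega
        · push Not at hall
          obtain ⟨a, ha, ham⟩ := hall
          have hle' : ∀ w ∈ s.erase v, (f w - if w ∈ A then 1 else 0) ≤ m - 1 := by
            intro w hw
            have hws := hle w (Finset.mem_of_mem_erase hw)
            by_cases hwA : w ∈ A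
            · simp only [hwA, if_true]; omega
            · have := hAt a ha w hw hwA
              simp only [hwA, if_false]; omega
          have hp' : ((s.erase v).filter
              (fun w => m - 1 < (f w - if w ∈ A then 1 else 0))).card = 0 := by
            rw [Finset.card_eq_zero, Finset.filter_eq_empty_iff]
            intro w hw
            have := hle' w hw
            omega
          refine RealOn.add_vertex hv hA hAc hpos
            (ih (s.erase v) _ (m - 1) (by omega) (even_step hv hA hAc hpos he) ?_ ?_ ?_ ?_)
          · refine le_trans (by omega) (hH'.trans (Finset.card_le_card ?_))
            intro w hw
            rw [Finset.mem_filter] at hw ⊢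
            refine ⟨hw.1, ?_⟩
            have := hw.2
            split_ifs <;> omega
          · rw [hp']; omega
          · intro w hw; rw [hp']; omega
          · intro w hw
            have := hle' w hw
            omega
    · -- remove a vertex of large value
      obtain ⟨v, hvP⟩ := Finset.card_pos.1 (Nat.pos_of_ne_zero hp)
      obtain ⟨hv, hvm⟩ := Finset.mem_filter.1 hvP
      have htc := Finset.card_erase_of_mem hv
      have hfv := hup v hv
      obtain ⟨A, hA, hAc, hAt⟩ := exists_top f (s.erase v) (f v) (by omega)
      have hAs : ∀ a ∈ A, a ∈ s := fun a ha => Finset.mem_of_mem_erase (hA ha)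
      have hpos : ∀ a ∈ A, 1 ≤ f a := by
        intro a ha
        have := hlow a (hAs a ha)
        omega
      have hPe := Finset.card_erase_of_mem hvP
      by_cases hall : ∀ a ∈ A, m ≤ f a
      · have hp' : ((s.erase v).filter
            (fun w => m < (f w - if w ∈ A then 1 else 0))).card
            ≤ (s.filter (fun w => m < f w)).card - 1 := by
          rw [← hPe]
          refine Finset.card_le_card ?_
          intro w hw
          rw [Finset.mem_filter, Finset.mem_erase] at hw
          rw [Finset.mem_erase, Finset.mem_filter]
          exact ⟨hw.1.1, hw.1.2, by omega⟩
        have hnA : ∀ w ∈ s.erase v, w ∉ A → f w ≤ m := by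
          intro w hw hwA
          by_contra hcon
          have : A ⊆ (s.filter (fun w => m < f w)) := by
            intro a ha
            have := hAt a ha w hw hwA
            exact Finset.mem_filter.2 ⟨hAs a ha, by omega⟩
          have := Finset.card_le_card this
          omega
        refine RealOn.add_vertex hv hA hAc hpos
          (ih (s.erase v) _ m (by omega) (even_step hv hA hAc hpos he) ?_ ?_ ?_ ?_)
        · refine le_trans (show m + 1 ≤ A.card by omega) (Finset.card_le_card ?_)
          intro w hw
          rw [Finset.mem_filter]
          refine ⟨hA hw, ?_⟩
          have := hall w hw
          simp only [hw, if_true]; omega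
        · omega
        · intro w hw
          have := hlow w (Finset.mem_of_mem_erase hw)
          split_ifs <;> omega
        · intro w hw
          have := hup w (Finset.mem_of_mem_erase hw)
          by_cases hwA : w ∈ A
          · have := hpos w hwA
            simp only [hwA, if_true]; omega
          · have := hnA w hw hwA
            simp only [hwA, if_false]; omega
      · push Not at hall
        obtain ⟨a, ha, ham⟩ := hall
        have hnA : ∀ w ∈ s.erase v, w ∉ A → f w < m := by
          intro w hw hwA
          have := hAt a ha w hw hwA
          omega
        have hp' : ((s.erase v).filter
            (fun w => m - 1 < (f w - if w ∈ A then 1 else 0))).card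
            ≤ (s.filter (fun w => m < f w)).card - 1 := by
          rw [← hPe]
          refine Finset.card_le_card ?_
          intro w hw
          rw [Finset.mem_filter] at hw
          have h1 := Finset.mem_erase.1 hw.1
          rw [Finset.mem_erase, Finset.mem_filter]
          refine ⟨h1.1, h1.2, ?_⟩
          have h2 := hw.2
          by_cases hwA : w ∈ A
          · simp only [hwA, if_true] at h2; omega
          · have := hnA w hw.1 hwA
            simp only [hwA, if_false] at h2; omega
        refine RealOn.add_vertex hv hA hAc hpos
          (ih (s.erase v) _ (m - 1) (by omega) (even_step hv hA hAc hpos he) ?_ ?_ ?_ ?_)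
        · have hvH : v ∈ s.filter (fun w => m ≤ f w + 1) :=
            Finset.mem_filter.2 ⟨hv, by omega⟩
          have h1 := Finset.card_erase_of_mem hvH
          refine le_trans (show m - 1 + 1 ≤
            ((s.filter (fun w => m ≤ f w + 1)).erase v).card by omega) (Finset.card_le_card ?_)
          intro w hw
          rw [Finset.mem_erase, Finset.mem_filter] at hw
          rw [Finset.mem_filter, Finset.mem_erase]
          refine ⟨⟨hw.1, hw.2.1⟩, ?_⟩
          have := hw.2.2
          split_ifs <;> omega
        · omega
        · intro w hw
          have := hlow w (Finset.mem_of_mem_erase hw)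
          split_ifs <;> omega
        · intro w hw
          have := hup w (Finset.mem_of_mem_erase hw)
          by_cases hwA : w ∈ A
          · have := hpos w hwA
            simp only [hwA, if_true]; omega
          · have := hnA w hw hwA
            simp only [hwA, if_false]; omega

/-- Transport along an injection onto `s`. -/
lemma graphic_of_realOn {n N : ℕ} {s : Finset (Fin n)} {f : Fin n → ℕ} (h : RealOn s f)
    (ι : Fin N → Fin n) (hι : Function.Injective ι) (hr : ∀ i, i ∈ s ↔ ∃ j, ι j = i) :
    Graphic (fun j => f (ι j)) := by
  obtain ⟨G, hG, hd⟩ := h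
  refine ⟨G.comap ι, fun j => ?_⟩
  show _ = f (ι j)
  rw [← hd (ι j) ((hr _).2 ⟨j, rfl⟩), ← Set.ncard_image_of_injective _ hι]
  congr 1
  ext b
  simp only [Set.mem_image, SimpleGraph.mem_neighborSet, SimpleGraph.comap_adj]
  constructor
  · rintro ⟨c, hc, rfl⟩; exact hc
  · intro hb
    obtain ⟨c, rfl⟩ := (hr b).1 (hG _ _ hb).2
    exact ⟨c, hb, rfl⟩

lemma Graphic.even_sum {n : ℕ} {d : Fin n → ℕ} (h : Graphic d) : Even (∑ i, d i) := by
  classical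
  obtain ⟨G, hG⟩ := h
  have : ∑ i, d i = ∑ i, G.degree i := by
    refine Finset.sum_congr rfl fun i _ => ?_
    rw [← hG i, Set.ncard_eq_toFinset_card', ← SimpleGraph.card_neighborSet_eq_degree,
      Set.toFinset_card]
  rw [this, G.sum_degrees_eq_twice_card_edges]
  simp

lemma Graphic.lt {n : ℕ} {d : Fin n → ℕ} (h : Graphic d) (i : Fin n) : d i < n := by
  classical
  obtain ⟨G, hG⟩ := h
  have h1 := G.degree_lt_card_verts i
  rw [Fintype.card_fin] at h1
  rwa [← hG i, Set.ncard_eq_toFinset_card', Set.toFinset_card,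
      SimpleGraph.card_neighborSet_eq_degree]

/-- The common core of both cases. -/
lemma core {n m p k : ℕ} (hm : 5 ≤ m) (hn : 2 * m + 1 ≤ n) {d : Fin n → ℕ}
    (hgr : Graphic d) (x y : Fin n) (hx : (x : ℕ) = m + 1) (hy : (y : ℕ) = 2 * m - 1)
    (hdx : d x = m) (hdy : d y = k) (hpm : p ≤ m)
    (hlow : ∀ i, 1 ≤ p → p + 2 ≤ d i)
    (hbig : ∀ i : Fin n, (i : ℕ) < p → m + 1 ≤ d i)
    (hmid : ∀ i : Fin n, p ≤ (i : ℕ) → (i : ℕ) ≤ m → d i = m)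
    (hsmall : ∀ i : Fin n, p ≤ (i : ℕ) → d i ≤ m)
    (dec : Fin n → ℕ) (h2 : ∀ i : Fin n, (i : ℕ) < p → dec i = 2)
    (h1 : ∀ i : Fin n, p ≤ (i : ℕ) → dec i ≤ 1)
    (hdec : ∀ i, i ≠ x → i ≠ y → dec i ≤ d i)
    (hsum : ∑ i ∈ (Finset.univ.erase x).erase y, dec i = m + k) :
    RealOn ((Finset.univ.erase x).erase y) (fun i => d i - dec i) := by
  have hxy : y ≠ x := by
    intro h; rw [h] at hy; omega
  have hyx : y ∈ Finset.univ.erase x := by simp [hxy]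
  set s := (Finset.univ.erase x).erase y with hs
  have hcard : s.card = n - 2 := by
    rw [hs, Finset.card_erase_of_mem hyx, Finset.card_erase_of_mem (Finset.mem_univ _),
      Finset.card_univ, Fintype.card_fin]
    omega
  have hms : ∀ i, i ∈ s ↔ i ≠ y ∧ i ≠ x := by intro i; simp [hs]
  have hP : (s.filter (fun i => m < d i - dec i)).card ≤ p := by
    calc _ ≤ ((Finset.range p).attachFin (n := n)
            (fun i hi => by have := Finset.mem_range.1 hi; omega)).card := by
          refine Finset.card_le_card fun i hi => ?_
          rw [Finset.mem_filter] at hi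
          rw [Finset.mem_attachFin, Finset.mem_range]
          by_contra hcon
          have := hsmall i (by omega)
          omega
      _ = p := by simp
  refine realOn_of_class (n - 2) s _ m hcard ?_ ?_ (hP.trans hpm) ?_ ?_
  · have e1 : ∑ i ∈ s, (d i - dec i) + ∑ i ∈ s, dec i = ∑ i ∈ s, d i := by
      rw [← Finset.sum_add_distrib]
      refine Finset.sum_congr rfl fun i hi => ?_
      have := hdec i ((hms i).1 hi).2 ((hms i).1 hi).1
      omega
    have e2 := Finset.add_sum_erase _ d hyx
    have e3 := Finset.add_sum_erase _ d (Finset.mem_univ x)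
    have e4 := hgr.even_sum
    rw [hsum] at e1
    rw [← hs] at e2
    grind
  · calc m + 1 = ((Finset.range (m + 1)).attachFin (n := n)
            (fun i hi => by have := Finset.mem_range.1 hi; omega)).card := by simp
      _ ≤ _ := by
          refine Finset.card_le_card fun i hi => ?_
          rw [Finset.mem_attachFin, Finset.mem_range] at hi
          rw [Finset.mem_filter, hms]
          refine ⟨⟨fun h => ?_, fun h => ?_⟩, ?_⟩
          · rw [h] at hi; omega
          · rw [h] at hi; omega
          · by_cases hip : (i : ℕ) < p
            · have := hbig i hip
              have := h2 i hip
              omega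
            · have := hmid i (by omega) (by omega)
              have := h1 i (by omega)
              omega
  · intro i hi
    refine hP.trans ?_
    by_cases hp : 1 ≤ p
    · have := hlow i hp
      by_cases hip : (i : ℕ) < p
      · have := h2 i hip
        omega
      · have := h1 i (by omega)
        omega
    · omega
  · intro i hi
    rw [hcard]
    by_cases hip : (i : ℕ) < p
    · have := h2 i hip
      have := hgr.lt i
      omega
    · have := hsmall i (by omega)
      omega

lemma sum_ind {n : ℕ} (a b : ℕ) (hb : b ≤ n) :
    ∑ i : Fin n, (if a ≤ (i : ℕ) ∧ (i : ℕ) < b then 1 else 0) = b - a := by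
  rw [Fin.sum_univ_eq_sum_range (fun i => if a ≤ i ∧ i < b then 1 else 0) n,
    ← Finset.sum_filter, Finset.sum_const, smul_eq_mul, mul_one]
  have : (Finset.range n).filter (fun i => a ≤ i ∧ i < b) = Finset.Ico a b := by
    ext i; simp; omega
  rw [this, Nat.card_Ico]

/-- **Lemma 2.5.** Let `m ≥ 5`, `n ≥ 2m+1` and `π = (d₁,…,dₙ)` be a non-increasing
graphic sequence with `m-1 ≥ d_{2m} ≥ d_{2m+1} ≥ 1`, `d_{dₙ-1} = ⋯ = d_{m+1} = m` and
`d_{2m+1-i} ≥ i+1` for `1 ≤ i ≤ m-1`. Let `p = max{i : dᵢ ≥ m+1}`. Then `ω₂`, obtained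
from `π` by deleting the terms `d_{m+2}` and `d_{2m}` and decreasing the indicated terms
(by two for the first `p` terms and by one for the others indicated), is graphic. Below
`ω₂` is indexed by `Fin (n-2)`; position `j` corresponds to the original (0-based)
position `j` if `j < m+1`, to `j+1` if `m+1 ≤ j < 2m-2`, and to `j+2` otherwise. -/
theorem lemma25 (m n : ℕ) (hm : 5 ≤ m) (hn : 2 * m + 1 ≤ n) (d : Fin n → ℕ)
    (hanti : Antitone d) (hgr : Graphic d)
    (dn : ℕ) (hdn_def : dn = d ⟨n - 1, by omega⟩)
    (d2m : ℕ) (hd2m_def : d2m = d ⟨2 * m - 1, by omega⟩)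
    (hd2m_ub : d2m ≤ m - 1) (h2m1_ub : d ⟨2 * m, by omega⟩ ≤ d2m)
    (h2m1_lb : 1 ≤ d ⟨2 * m, by omega⟩)
    (hmid : ∀ i : ℕ, ∀ _ : dn - 1 ≤ i, ∀ _ : 1 ≤ i, ∀ _ : i ≤ m + 1, d ⟨i - 1, by omega⟩ = m)
    (hposa : ∀ i : ℕ, ∀ _ : 1 ≤ i, ∀ _ : i ≤ m - 1, i + 1 ≤ d ⟨2 * m - i, by omega⟩)
    (p : ℕ) (hpn : p ≤ n)
    (hp1 : ∀ i : ℕ, ∀ _ : 1 ≤ i, ∀ _ : i ≤ p, m + 1 ≤ d ⟨i - 1, by omega⟩)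
    (hp2 : ∀ i : ℕ, ∀ _ : p < i, ∀ _ : i ≤ n, d ⟨i - 1, by omega⟩ ≤ m) :
    (1 ≤ p ∨ d2m ≤ m - 2 →
      Graphic (fun j : Fin (n - 2) =>
        let i : Fin n :=
          if (j : ℕ) < m + 1 then ⟨(j : ℕ), by omega⟩
          else if (j : ℕ) < 2 * m - 2 then ⟨(j : ℕ) + 1, by omega⟩
          else ⟨(j : ℕ) + 2, by omega⟩
        d i - (if (i : ℕ) < p then 2
               else if (i : ℕ) ≤ m then 1
               else if m + 2 ≤ (i : ℕ) ∧ (i : ℕ) ≤ m + d2m - p then 1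
               else 0))) ∧
    (p = 0 ∧ d2m = m - 1 →
      Graphic (fun j : Fin (n - 2) =>
        let i : Fin n :=
          if (j : ℕ) < m + 1 then ⟨(j : ℕ), by omega⟩
          else if (j : ℕ) < 2 * m - 2 then ⟨(j : ℕ) + 1, by omega⟩
          else ⟨(j : ℕ) + 2, by omega⟩
        d i - (if (i : ℕ) ≤ 2 * m then 1 else 0))) := by
  have hdle : ∀ i : Fin n, dn ≤ d i := by
    intro i
    rw [hdn_def]
    exact hanti (Fin.le_def.2 (by have := i.2; simp only; omega))
  have hdn1 : dn ≤ m - 1 := (hdle ⟨2 * m, by omega⟩).trans (h2m1_ub.trans hd2m_ub)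
  have hpdn : 1 ≤ p → p + 2 ≤ dn := by
    intro hp
    by_contra hcon
    by_cases h : dn - 1 ≤ 1
    · have := hmid 1 h le_rfl (by omega)
      have := hp1 1 le_rfl hp
      omega
    · have := hmid (dn - 1) le_rfl (by omega) (by omega)
      have := hp1 (dn - 1) (by omega) (by omega)
      omega
  have hk2 : p + 2 ≤ d2m := by
    by_cases hp : 1 ≤ p
    · have := hpdn hp
      have := hdle ⟨2 * m - 1, by omega⟩
      omega
    · have := hposa 1 le_rfl (by omega)
      omega
  have hbig : ∀ i : Fin n, (i : ℕ) < p → m + 1 ≤ d i := by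
    intro i hi
    exact hp1 (i + 1) (by omega) (by omega)
  have hsmall : ∀ i : Fin n, p ≤ (i : ℕ) → d i ≤ m := by
    intro i hi
    exact hp2 (i + 1) (by omega) (by have := i.2; omega)
  have hge : ∀ i : Fin n, (i : ℕ) ≤ m + 1 → m ≤ d i := by
    intro i hi
    have h1 := hposa (m - 1) (by omega) le_rfl
    have h2 : d ⟨2 * m - (m - 1), by omega⟩ ≤ d i :=
      hanti (Fin.le_def.2 (by simp only; omega))
    omega
  have hpos : ∀ i : Fin n, (i : ℕ) ≤ 2 * m → 1 ≤ d i := by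
    intro i hi
    exact h2m1_lb.trans (hanti (Fin.le_def.2 (by simpa using hi)))
  let x : Fin n := ⟨m + 1, by omega⟩
  let y : Fin n := ⟨2 * m - 1, by omega⟩
  have hxv : (x : ℕ) = m + 1 := rfl
  have hyv : (y : ℕ) = 2 * m - 1 := rfl
  have hdx : d x = m := le_antisymm (hsmall x (by omega)) (hge x (by omega))
  have hxy : y ≠ x := by
    intro h; rw [h] at hyv; omega
  have hyx : y ∈ Finset.univ.erase x := by simp [hxy]
  have hlow : ∀ i, 1 ≤ p → p + 2 ≤ d i := fun i hp => (hpdn hp).trans (hdle i)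
  have hmid' : ∀ i : Fin n, p ≤ (i : ℕ) → (i : ℕ) ≤ m → d i = m :=
    fun i h1 h2 => le_antisymm (hsmall i h1) (hge i (by omega))
  let ι : Fin (n - 2) → Fin n := fun j =>
    if (j : ℕ) < m + 1 then ⟨(j : ℕ), by omega⟩
    else if (j : ℕ) < 2 * m - 2 then ⟨(j : ℕ) + 1, by omega⟩
    else ⟨(j : ℕ) + 2, by omega⟩
  have hιv : ∀ j, ((ι j : Fin n) : ℕ) = if (j : ℕ) < m + 1 then (j : ℕ)
      else if (j : ℕ) < 2 * m - 2 then (j : ℕ) + 1 else (j : ℕ) + 2 := by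
    intro j
    simp only [ι]
    split_ifs <;> rfl
  have hιi : Function.Injective ι := by
    intro a b hab
    have h := congrArg Fin.val hab
    rw [hιv, hιv] at h
    apply Fin.ext
    split_ifs at h <;> omega
  have hιr : ∀ i, i ∈ (Finset.univ.erase x).erase y ↔ ∃ j, ι j = i := by
    intro i
    simp only [Finset.mem_erase, Finset.mem_univ, and_true]
    rw [Ne, Ne, Fin.ext_iff, Fin.ext_iff, hxv, hyv]
    have hi := i.2
    constructor
    · rintro ⟨h1, h2⟩
      by_cases ha : (i : ℕ) < m + 1
      · refine ⟨⟨i, by omega⟩, Fin.ext ?_⟩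
        rw [hιv]; simp only; split_ifs <;> omega
      · by_cases hb : (i : ℕ) < 2 * m - 1
        · refine ⟨⟨i - 1, by omega⟩, Fin.ext ?_⟩
          rw [hιv]; simp only; split_ifs <;> omega
        · refine ⟨⟨i - 2, by omega⟩, Fin.ext ?_⟩
          rw [hιv]; simp only; split_ifs <;> omega
    · rintro ⟨j, rfl⟩
      rw [hιv]
      split_ifs <;> omega
  constructor
  · intro hcase
    let dec : Fin n → ℕ := fun i =>
      if (i : ℕ) < p then 2
      else if (i : ℕ) ≤ m then 1
      else if m + 2 ≤ (i : ℕ) ∧ (i : ℕ) ≤ m + d2m - p then 1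
      else 0
    have hR : RealOn ((Finset.univ.erase x).erase y) (fun i => d i - dec i) := by
      refine core (p := p) (k := d2m) hm hn hgr x y hxv hyv hdx hd2m_def.symm (by omega)
        hlow hbig hmid' hsmall dec ?_ ?_ ?_ ?_
      · intro i hi; simp [dec, hi]
      · intro i hi
        simp only [dec]
        split_ifs <;> omega
      · intro i _ _
        simp only [dec]
        split_ifs with h1 h2 h3
        · have := hbig i h1; omega
        · exact hpos i (by omega)
        · exact hpos i (by omega)
        · omega
      · have e2 := Finset.add_sum_erase _ dec hyx
        have e3 := Finset.add_sum_erase _ dec (Finset.mem_univ x)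
        have hx0 : dec x = 0 := by
          simp only [dec, hxv]
          split_ifs <;> omega
        have hy0 : dec y = 0 := by
          simp only [dec, hyv]
          split_ifs <;> omega
        have e4 : ∑ i, dec i = (p - 0) + ((m + 1) - 0) + ((m + d2m - p + 1) - (m + 2)) := by
          rw [← sum_ind (n := n) 0 p (by omega), ← sum_ind (n := n) 0 (m + 1) (by omega),
            ← sum_ind (n := n) (m + 2) (m + d2m - p + 1) (by omega),
            ← Finset.sum_add_distrib, ← Finset.sum_add_distrib]
          refine Finset.sum_congr rfl fun i _ => ?_
          simp only [dec]
          split_ifs <;> omega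
        omega
    exact graphic_of_realOn hR ι hιi hιr
  · rintro ⟨hp0, hkm⟩
    let dec : Fin n → ℕ := fun i => if (i : ℕ) ≤ 2 * m then 1 else 0
    have hR : RealOn ((Finset.univ.erase x).erase y) (fun i => d i - dec i) := by
      refine core (p := p) (k := d2m) hm hn hgr x y hxv hyv hdx hd2m_def.symm (by omega)
        hlow hbig hmid' hsmall dec ?_ ?_ ?_ ?_
      · intro i hi; omega
      · intro i hi
        simp only [dec]
        split_ifs <;> omega
      · intro i _ _
        simp only [dec]
        split_ifs with h1
        · exact hpos i h1
        · omega
      · have e2 := Finset.add_sum_erase _ dec hyx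
        have e3 := Finset.add_sum_erase _ dec (Finset.mem_univ x)
        have hx0 : dec x = 1 := by
          simp only [dec, hxv]
          split_ifs <;> omega
        have hy0 : dec y = 1 := by
          simp only [dec, hyv]
          split_ifs <;> omega
        have e4 : ∑ i, dec i = (2 * m + 1) - 0 := by
          rw [← sum_ind (n := n) 0 (2 * m + 1) (by omega)]
          refine Finset.sum_congr rfl fun i _ => ?_
          simp only [dec]
          split_ifs <;> omega
        omega
    exact graphic_of_realOn hR ι hιi hιr
end
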